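/- arXiv:2512.21112 — 3 statements merged into one kernel-verified Lean document; each statement's English description precedes it below -/
import Mathlib

section
/- (Conjunctive source coding theorem) Let X be a hyperconfusion over a finite probability space (Ω, p), and for each n let X₁,…,Xₙ be its n-fold i.i.d. hyperconfusion sequence over (Ωⁿ, p^⊗ⁿ). Then lim_{n→∞} H(∩_{i=1}^n Xᵢ)/n = H(X), and lim_{n→∞} (1/n) · min_{M ∈ OIs(Ωⁿ), M ⊆ ∩_{i=1}^n Xᵢ} H(M) = H(X) (limits taken in [0,∞]). -/
open Finset
open scoped Classical ENNReal

noncomputable section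

variable {Ω : Type*}

/-- `X` is a confusion hypergraph (hyperconfusion) over `Ω`: a nonempty,
downward-closed family of subsets of `Ω`. -/
def IsHyp (X : Finset (Finset Ω)) : Prop :=
  X.Nonempty ∧ ∀ A ∈ X, ∀ B ⊆ A, B ∈ X

/-- `p` is a probability mass function on the finite type `Ω`. -/
def IsPMF [Fintype Ω] (p : Ω → ℝ) : Prop :=
  (∀ ω, 0 ≤ p ω) ∧ ∑ ω : Ω, p ω = 1

/-- The probability of a set `A` under the pmf `p`. -/
def pset (p : Ω → ℝ) (A : Finset Ω) : ℝ := ∑ ω ∈ A, p ω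

/-- A valid conditional pmf `k` from `Ω` to (pmfs on) `X`: nonnegative, sums to one,
supported on `X`, and `k A z > 0` with `p z > 0` implies `z ∈ A`. -/
def ValidK [Fintype Ω] (p : Ω → ℝ) (X : Finset (Finset Ω)) (k : Ω → Finset Ω → ℝ) : Prop :=
  (∀ z A, 0 ≤ k z A) ∧ (∀ z, ∑ A : Finset Ω, k z A = 1) ∧
    (∀ z A, 0 < k z A → A ∈ X) ∧ ∀ z A, 0 < p z → 0 < k z A → z ∈ A

/-- The mutual information `I(Z;A)` where `Z ∼ p` and `A | Z ∼ k`. -/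
def MI [Fintype Ω] (p : Ω → ℝ) (k : Ω → Finset Ω → ℝ) : ℝ :=
  ∑ z : Ω, ∑ A : Finset Ω,
    p z * k z A * Real.logb 2 (k z A / ∑ z' : Ω, p z' * k z' A)

/-- The entropy `H(X)` of a hyperconfusion `X` over `(Ω, p)`, valued in `[0,∞]`
(`∞` when no valid conditional pmf exists). -/
def Hent [Fintype Ω] (p : Ω → ℝ) (X : Finset (Finset Ω)) : ℝ≥0∞ :=
  ⨅ (k : Ω → Finset Ω → ℝ) (_ : ValidK p X k), ENNReal.ofReal (MI p k)

/-- `−log₂ x = log₂ (1/x)`, valued in `[0,∞]` (equals `∞` when `x ≤ 0`). -/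
def negLog2 (x : ℝ) : ℝ≥0∞ :=
  if x ≤ 0 then ⊤ else ENNReal.ofReal (Real.logb 2 x⁻¹)

/-- The min-entropy `H∞(X) = −log₂ max_{A ∈ X} p(A)`. -/
def Hmin [Fintype Ω] (p : Ω → ℝ) (X : Finset (Finset Ω)) : ℝ≥0∞ :=
  ⨅ A ∈ X, negLog2 (pset p A)

/-- The integral max-entropy `H₀(X)`: `log₂` of the minimum cardinality of a subfamily
of `X` covering `supp(p)` (`∞` if there is none). -/
def H0ent [Fintype Ω] (p : Ω → ℝ) (X : Finset (Finset Ω)) : ℝ≥0∞ :=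
  ⨅ (S : Finset (Finset Ω))
    (_ : S ⊆ X ∧ ∀ ω : Ω, 0 < p ω → ∃ A ∈ S, ω ∈ A),
    ENNReal.ofReal (Real.logb 2 (S.card : ℝ))

/-- The fractional max-entropy `Hε(X)`: `log₂` of the minimum total weight of a
fractional covering of `supp(p)` by members of `X` (`∞` if there is none). -/
def Heps [Fintype Ω] (p : Ω → ℝ) (X : Finset (Finset Ω)) : ℝ≥0∞ :=
  ⨅ (μ : Finset Ω → ℝ)
    (_ : (∀ A, 0 ≤ μ A) ∧ (∀ A, μ A ≠ 0 → A ∈ X) ∧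
      ∀ ω : Ω, 0 < p ω → 1 ≤ ∑ A ∈ X, if ω ∈ A then μ A else 0),
    ENNReal.ofReal (Real.logb 2 (∑ A ∈ X, μ A))

/-- The support of the pmf `p`. -/
def suppP [Fintype Ω] (p : Ω → ℝ) : Finset Ω := univ.filter fun ω => 0 < p ω

/-- The support of a hyperconfusion: the points whose singleton is confusable. -/
def suppH [Fintype Ω] (X : Finset (Finset Ω)) : Finset Ω :=
  univ.filter fun ω => ({ω} : Finset Ω) ∈ X

/-- `X` is an ordinary information: the union of the powersets of a nonempty collection
of pairwise disjoint subsets of `Ω`. -/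
def IsOI (X : Finset (Finset Ω)) : Prop :=
  ∃ S : Finset (Finset Ω), S.Nonempty ∧
    (∀ A ∈ S, ∀ B ∈ S, A ≠ B → Disjoint A B) ∧
    ∀ C : Finset Ω, C ∈ X ↔ ∃ A ∈ S, C ⊆ A

/-- The Heyting implication `X → Y := {A ⊆ Ω : X ∩ 2^A ⊆ Y}` of hyperconfusions. -/
def himpHyp [Fintype Ω] (X Y : Finset (Finset Ω)) : Finset (Finset Ω) :=
  univ.filter fun A => ∀ B ∈ X, B ⊆ A → B ∈ Y

/-- `log₂` on `[0,∞]`. -/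
def elog2 (x : ℝ≥0∞) : ℝ≥0∞ :=
  if x = ⊤ then ⊤ else ENNReal.ofReal (Real.logb 2 x.toReal)

/-- The maximal members of a hyperconfusion (under inclusion). -/
def maxsHyp (X : Finset (Finset Ω)) : Finset (Finset Ω) :=
  X.filter fun A => ∀ B ∈ X, A ⊆ B → B = A

/-- The indicator vector of `A ⊆ Ω`, as an element of `ℝ^Ω`. -/
def indVec (A : Finset Ω) : Ω → ℝ := fun ω => if ω ∈ A then 1 else 0

/-- The ordinary information `oi(f) = {A : |f(A)| ≤ 1}` induced by a function `f`. -/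
def oiF {Ω' : Type*} [Fintype Ω] (f : Ω → Ω') : Finset (Finset Ω) :=
  univ.filter fun A : Finset Ω => (A.image f).card ≤ 1

/-- Independence of two hyperconfusions: all unions of maximal confusable sets are
independent events. -/
def IndepHyp [Fintype Ω] (p : Ω → ℝ) (X Y : Finset (Finset Ω)) : Prop :=
  ∀ S ⊆ maxsHyp X, ∀ T ⊆ maxsHyp Y,
    pset p ((S.biUnion id) ∩ (T.biUnion id)) =
      pset p (S.biUnion id) * pset p (T.biUnion id)

/-- The embedding `Xᵢ` of a hyperconfusion `X` over `Ω` into the product space `Ωⁿ`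
along coordinate `i`. -/
def embedHyp [Fintype Ω] (X : Finset (Finset Ω)) (n : ℕ) (i : Fin n) :
    Finset (Finset (Fin n → Ω)) :=
  univ.filter fun C => ∃ A ∈ X, ∀ ω ∈ C, ω i ∈ A

/-- The i.i.d. product pmf `p^⊗ⁿ` on `Ωⁿ`. -/
def pPow [Fintype Ω] (p : Ω → ℝ) (n : ℕ) : (Fin n → Ω) → ℝ :=
  fun ω => ∏ i, p (ω i)

/-- The conditional pmf `p(·|E)` (supported on `E`). -/
def condP [Fintype Ω] (p : Ω → ℝ) (E : Finset Ω) : Ω → ℝ :=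
  fun ω => if ω ∈ E then p ω / pset p E else 0

/-- The conditional entropy `H(X|E)` of the hyperconfusion `X ∩ 2^E` over the
conditional probability space `(E, p(·|E))`. -/
def HcondEvent [Fintype Ω] (p : Ω → ℝ) (X : Finset (Finset Ω)) (E : Finset Ω) : ℝ≥0∞ :=
  Hent (condP p E) (X ∩ E.powerset)

/-- The conditional entropy `H(X|Y) := p(E)·(H(X∩Y|E) − H(Y|E))` where `E = supp(Y)`,
taken to be `0` when `p(E) = 0`. -/
def Hcond [Fintype Ω] (p : Ω → ℝ) (X Y : Finset (Finset Ω)) : ℝ≥0∞ :=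
  if pset p (suppH Y) = 0 then 0
  else ENNReal.ofReal (pset p (suppH Y)) *
    (HcondEvent p (X ∩ Y) (suppH Y) - HcondEvent p Y (suppH Y))

/-- The singleton hyperconfusion `sing(Ω) = {∅} ∪ {{ω} : ω ∈ Ω}`. -/
def singHyp (α : Type*) [Fintype α] : Finset (Finset α) :=
  insert ∅ (univ.image fun ω : α => ({ω} : Finset α))

/-- A valid pmf `q` on `Ỹ` for the coarse entropy: supported on `Yt`, and dominating `p`
in the sense that `p(S) ≤ Σ_{B ∈ Yt, S∩B ≠ ∅} q(B)` for all `S`. -/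
def ValidQ [Fintype Ω] (p : Ω → ℝ) (Yt : Finset (Finset Ω)) (q : Finset Ω → ℝ) : Prop :=
  (∀ B, 0 ≤ q B) ∧ (∀ B, q B ≠ 0 → B ∈ Yt) ∧ (∑ B : Finset Ω, q B = 1) ∧
    ∀ S : Finset Ω, pset p S ≤ ∑ B ∈ Yt, if (S ∩ B).Nonempty then q B else 0

/-- A valid conditional pmf `m` from `Ỹ` to `X` for the coarse entropy:
`m A B > 0` with `q B > 0` implies `B ⊆ A`. -/
def ValidM [Fintype Ω] (X : Finset (Finset Ω)) (q : Finset Ω → ℝ)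
    (m : Finset Ω → Finset Ω → ℝ) : Prop :=
  (∀ B A, 0 ≤ m B A) ∧ (∀ B, ∑ A : Finset Ω, m B A = 1) ∧
    (∀ B A, 0 < m B A → A ∈ X) ∧ ∀ B A, 0 < q B → 0 < m B A → B ⊆ A

/-- The mutual information `I(B;A)` where `B ∼ q` and `A | B ∼ m`. -/
def MI2 [Fintype Ω] (q : Finset Ω → ℝ) (m : Finset Ω → Finset Ω → ℝ) : ℝ :=
  ∑ B : Finset Ω, ∑ A : Finset Ω,
    q B * m B A * Real.logb 2 (m B A / ∑ B' : Finset Ω, q B' * m B' A)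

/-- The coarse entropy `H(X ↘ Y)` of `X` with respect to `Y`. -/
def Hcoarse [Fintype Ω] (p : Ω → ℝ) (X Y : Finset (Finset Ω)) : ℝ≥0∞ :=
  if Y ∪ singHyp Ω ⊆ X then
    ⨆ (q : Finset Ω → ℝ) (_ : ValidQ p (Y ∪ singHyp Ω) q),
      ⨅ (m : Finset Ω → Finset Ω → ℝ) (_ : ValidM X q m), ENNReal.ofReal (MI2 q m)
  else ⊤

/-- The capacity `C(X) = max_p H(X)` of a hyperconfusion. -/
def capacity [Fintype Ω] (X : Finset (Finset Ω)) : ℝ≥0∞ :=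
  ⨆ (p : Ω → ℝ) (_ : IsPMF p), Hent p X

/-- The product hyperconfusion `X ⊗ Y` over `Ω × Γ`. -/
def prodHyp {Γ : Type*} [Fintype Ω] [Fintype Γ]
    (X : Finset (Finset Ω)) (Y : Finset (Finset Γ)) : Finset (Finset (Ω × Γ)) :=
  univ.filter fun C => ∃ A ∈ X, ∃ B ∈ Y, ∀ c ∈ C, c.1 ∈ A ∧ c.2 ∈ B

/-- The `n`-fold product hyperconfusion `X^⊗ⁿ` over `Ωⁿ`. -/
def powHyp [Fintype Ω] (X : Finset (Finset Ω)) (n : ℕ) : Finset (Finset (Fin n → Ω)) :=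
  univ.filter fun C => ∃ A : Fin n → Finset Ω, (∀ i, A i ∈ X) ∧ ∀ ω ∈ C, ∀ i, ω i ∈ A i

/-- `X ⊑ Y`: there is a surjective hyperconfusable set-valued function from `(Ω,X)`
to `(Γ,Y)`. -/
def ConfusesOnto {Γ : Type*} [Fintype Ω] [Fintype Γ]
    (X : Finset (Finset Ω)) (Y : Finset (Finset Γ)) : Prop :=
  ∃ β : Ω → Finset Γ, (∀ A ∈ X, A.biUnion β ∈ Y) ∧ univ.biUnion β = univ

/-- The confusion ratio `CR(X/Y) = sup{m/n : X^⊗ⁿ ⊑ Y^⊗ᵐ}`. -/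
def confRatio {Γ : Type*} [Fintype Ω] [Fintype Γ]
    (X : Finset (Finset Ω)) (Y : Finset (Finset Γ)) : ℝ≥0∞ :=
  ⨆ (n : ℕ) (m : ℕ)
    (_ : 0 < n ∧ 0 < m ∧ ConfusesOnto (powHyp X n) (powHyp Y m)),
    (m : ℝ≥0∞) / (n : ℝ≥0∞)

lemma aux_jensen {ι : Type*} (s : Finset ι) (a x : ι → ℝ) (ha : ∀ i ∈ s, 0 ≤ a i)
    (h1 : ∑ i ∈ s, a i = 1) (hx : ∀ i ∈ s, 0 < a i → 0 < x i) (S : ℝ)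
    (hS : ∑ i ∈ s, a i * x i ≤ S) (hS0 : 0 < S) :
    ∑ i ∈ s, a i * Real.logb 2 (x i) ≤ Real.logb 2 S := by
  have hl : 0 < Real.log 2 := Real.log_pos (by norm_num)
  have key : ∀ i ∈ s, a i * Real.log (x i) ≤ a i * x i / S - a i + a i * Real.log S := by
    intro i hi
    rcases (ha i hi).eq_or_lt with h | h
    · simp [← h]
    · have h2 := Real.log_le_sub_one_of_pos (div_pos (hx i hi h) hS0)
      rw [Real.log_div (hx i hi h).ne' hS0.ne'] at h2
      have h3 := mul_le_mul_of_nonneg_left h2 h.le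
      have : a i * x i / S = a i * (x i / S) := by ring
      rw [this]; nlinarith
  have h2 := Finset.sum_le_sum key
  rw [Finset.sum_add_distrib, Finset.sum_sub_distrib, ← Finset.sum_div, ← Finset.sum_mul, h1] at h2
  have h3 : (∑ i ∈ s, a i * x i) / S ≤ 1 := (div_le_one hS0).2 hS
  have h4 : ∑ i ∈ s, a i * Real.log (x i) ≤ Real.log S := by linarith
  have h5 : ∑ i ∈ s, a i * Real.logb 2 (x i) = (∑ i ∈ s, a i * Real.log (x i)) / Real.log 2 := by
    rw [Finset.sum_div]; refine Finset.sum_congr rfl fun i _ => ?_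
    unfold Real.logb; ring
  rw [h5]; unfold Real.logb
  gcongr

lemma aux_D1 {α : Type*} [Fintype α] (p : α → ℝ) (hp : IsPMF p) (Y : Finset (Finset α))
    (k : α → Finset α → ℝ) (hk : ValidK p Y k) :
    ∃ Q : Finset α → ℝ, (∀ A, 0 ≤ Q A) ∧ ∑ A, Q A = 1 ∧ (∀ A, Q A ≠ 0 → A ∈ Y) ∧
      (∀ z, 0 < p z → 0 < ∑ A, if z ∈ A then Q A else 0) ∧
      -(∑ z, p z * Real.logb 2 (∑ A, if z ∈ A then Q A else 0)) ≤ MI p k := by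
  obtain ⟨k0, k1, kX, kz⟩ := hk
  set Q : Finset α → ℝ := fun A => ∑ z, p z * k z A with hQ
  have Q0 : ∀ A, 0 ≤ Q A := fun A => Finset.sum_nonneg fun z _ => mul_nonneg (hp.1 z) (k0 z A)
  have Qpos : ∀ z A, 0 < p z → 0 < k z A → 0 < Q A := fun z A h1 h2 =>
    lt_of_lt_of_le (mul_pos h1 h2) (Finset.single_le_sum (f := fun z => p z * k z A)
      (fun z _ => mul_nonneg (hp.1 z) (k0 z A)) (Finset.mem_univ z))
  have qpos : ∀ z, 0 < p z → 0 < ∑ A, if z ∈ A then Q A else 0 := by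
    intro z hz
    have : ∃ A, 0 < k z A := by
      by_contra! h
      have := Finset.sum_nonpos (s := Finset.univ) fun A _ => h A
      rw [k1 z] at this; linarith
    obtain ⟨A, hA⟩ := this
    refine Finset.sum_pos' (fun A _ => by split_ifs <;> simp [Q0]) ⟨A, Finset.mem_univ _, ?_⟩
    rw [if_pos (kz z A hz hA)]; exact Qpos z A hz hA
  refine ⟨Q, Q0, ?_, ?_, qpos, ?_⟩
  · rw [hQ, Finset.sum_comm]; simp_rw [← Finset.mul_sum, k1, mul_one]; exact hp.2
  · intro A hA
    obtain ⟨z, -, hz⟩ := Finset.exists_ne_zero_of_sum_ne_zero hA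
    exact kX z A (lt_of_le_of_ne (k0 z A) fun h => hz (by simp [← h]))
  · unfold MI
    rw [← Finset.sum_neg_distrib]
    refine Finset.sum_le_sum fun z _ => ?_
    rcases (hp.1 z).eq_or_lt with h | h
    · simp [← h]
    · have := aux_jensen Finset.univ (k z) (fun A => Q A / k z A) (fun A _ => k0 z A) (k1 z)
        (fun A _ hA => div_pos (Qpos z A h hA) hA) _ (Finset.sum_le_sum (fun A _ => ?_)) (qpos z h)
      · simp_rw [mul_assoc, ← Finset.mul_sum]
        rw [← mul_neg]
        refine mul_le_mul_of_nonneg_left ?_ h.le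
        refine (neg_le_neg this).trans (le_of_eq ?_)
        rw [← Finset.sum_neg_distrib]
        refine Finset.sum_congr rfl fun A _ => ?_
        rw [← mul_neg, ← Real.logb_inv, inv_div]
      · rcases (k0 z A).eq_or_lt with h' | h'
        · rw [← h']; simp only [zero_mul]; split_ifs <;> simp [Q0]
        · rw [if_pos (kz z A h h')]; field_simp; rfl

lemma aux_D2 {α : Type*} [Fintype α] (p : α → ℝ) (hp : IsPMF p) (X : Finset (Finset α))
    (h0 : ∅ ∈ X) (Q : Finset α → ℝ) (Q0 : ∀ A, 0 ≤ Q A) (Q1 : ∑ A, Q A = 1)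
    (QX : ∀ A, Q A ≠ 0 → A ∈ X)
    (qpos : ∀ z, 0 < p z → 0 < ∑ A, if z ∈ A then Q A else 0) :
    Hent p X ≤ ENNReal.ofReal (-(∑ z, p z * Real.logb 2 (∑ A, if z ∈ A then Q A else 0))) := by
  set q : α → ℝ := fun z => ∑ A, if z ∈ A then Q A else 0 with hq
  set k : α → Finset α → ℝ := fun z A =>
    if 0 < p z then (if z ∈ A then Q A else 0) / q z else if A = ∅ then 1 else 0 with hk
  have k0 : ∀ z A, 0 ≤ k z A := by
    intro z A
    simp only [hk]
    split_ifs with h1 h2 <;> try positivity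
    · exact div_nonneg (Q0 A) (qpos z h1).le
    · simp
  have k1 : ∀ z, ∑ A, k z A = 1 := by
    intro z
    simp only [hk]
    split_ifs with h1
    · rw [← Finset.sum_div]; exact div_self (qpos z h1).ne'
    · simp
  have kv : ValidK p X k := by
    refine ⟨k0, k1, ?_, ?_⟩
    · intro z A h
      simp only [hk] at h
      split_ifs at h with h1 h2 h3
      · exact QX A fun h' => by simp [h'] at h
      · simp at h
      · rw [h3]; exact h0
      · simp at h
    · intro z A h1 h
      simp only [hk, if_pos h1] at h
      by_contra h2
      simp [h2] at h
  refine (iInf₂_le k kv).trans (ENNReal.ofReal_le_ofReal ?_)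
  set m : Finset α → ℝ := fun A => ∑ z, p z * k z A with hm
  have m0 : ∀ A, 0 ≤ m A := fun A => Finset.sum_nonneg fun z _ => mul_nonneg (hp.1 z) (k0 z A)
  have m1 : ∑ A, m A = 1 := by
    rw [hm, Finset.sum_comm]; simp_rw [← Finset.mul_sum, k1, mul_one]; exact hp.2
  have mQ : ∀ A, 0 < m A → 0 < Q A := by
    intro A hA
    obtain ⟨z, -, hz⟩ := Finset.exists_ne_zero_of_sum_ne_zero hA.ne'
    have hpz : 0 < p z := lt_of_le_of_ne (hp.1 z) fun h => hz (by simp [← h])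
    refine lt_of_le_of_ne (Q0 A) fun h => hz ?_
    simp [hk, hpz, ← h]
  have hj := aux_jensen Finset.univ m (fun A => Q A / m A) (fun A _ => m0 A) m1
    (fun A _ h => div_pos (mQ A h) h) 1 (by
      rw [← Q1]
      refine Finset.sum_le_sum fun A _ => ?_
      rcases (m0 A).eq_or_lt with h | h
      · simp [← h, Q0]
      · field_simp; rfl) one_pos
  rw [Real.logb_one] at hj
  have hexp : ∑ A, m A * Real.logb 2 (Q A / m A) =
      ∑ z, ∑ A, p z * k z A * Real.logb 2 (Q A / m A) := by
    rw [Finset.sum_comm]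
    exact Finset.sum_congr rfl fun A _ => by rw [hm, Finset.sum_mul]
  have hMI : MI p k = -(∑ z, p z * Real.logb 2 (q z)) +
      ∑ z, ∑ A, p z * k z A * Real.logb 2 (Q A / m A) := by
    unfold MI
    rw [← Finset.sum_neg_distrib, ← Finset.sum_add_distrib]
    refine Finset.sum_congr rfl fun z _ => ?_
    rw [show -(p z * Real.logb 2 (q z)) = ∑ A, p z * k z A * (- Real.logb 2 (q z)) by
      rw [← Finset.sum_mul, ← Finset.mul_sum, k1]; ring]
    rw [← Finset.sum_add_distrib]
    refine Finset.sum_congr rfl fun A _ => ?_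
    rcases (hp.1 z).eq_or_lt with h | h
    · simp [← h]
    rcases (k0 z A).eq_or_lt with h' | h'
    · simp [← h']
    have hmA : 0 < m A := lt_of_lt_of_le (mul_pos h h') (Finset.single_le_sum
      (f := fun z => p z * k z A)
      (fun z _ => mul_nonneg (hp.1 z) (k0 z A)) (Finset.mem_univ z))
    have hzA : z ∈ A := kv.2.2.2 z A h h'
    have hkz : k z A = Q A / q z := by simp [hk, h, hzA]
    have hqz := qpos z h
    rw [← mul_add]
    congr 1
    change Real.logb 2 (k z A / m A) = _
    rw [hkz, Real.logb_div (div_pos (mQ A hmA) hqz).ne' hmA.ne',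
      Real.logb_div (mQ A hmA).ne' hqz.ne', Real.logb_div (mQ A hmA).ne' hmA.ne']
    ring
  rw [hMI, ← hexp]; linarith

lemma aux_D2' {α : Type*} [Fintype α] (p : α → ℝ) (hp : IsPMF p) (X : Finset (Finset α))
    (h0 : ∅ ∈ X) (h : ℝ) (hh : ENNReal.ofReal h ≤ Hent p X) {ι : Type*} [Fintype ι]
    (W : ι → ℝ) (W0 : ∀ i, 0 ≤ W i) (B : ι → Finset α) (hB : ∀ i, B i ∈ X)
    (qpos : ∀ z, 0 < p z → 0 < ∑ i, if z ∈ B i then W i else 0) :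
    h - Real.logb 2 (∑ i, W i) ≤
      -(∑ z, p z * Real.logb 2 (∑ i, if z ∈ B i then W i else 0)) := by
  obtain ⟨z0, hz0⟩ : ∃ z, 0 < p z := by
    by_contra! h
    have := Finset.sum_nonpos (s := Finset.univ) fun A _ => h A
    rw [hp.2] at this; linarith
  set T := ∑ i, W i with hT
  have qle : ∀ z, (∑ i, if z ∈ B i then W i else 0) ≤ T := fun z =>
    Finset.sum_le_sum fun i _ => by split_ifs <;> simp [W0]
  have Tpos : 0 < T := (qpos z0 hz0).trans_le (qle z0)
  set Q : Finset α → ℝ := fun A => (∑ i, if B i = A then W i else 0) / T with hQ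
  have qq : ∀ z, (∑ A, if z ∈ A then Q A else 0) = (∑ i, if z ∈ B i then W i else 0) / T := by
    intro z
    have : ∀ A : Finset α, (if z ∈ A then Q A else 0) =
        (∑ i, if B i = A then (if z ∈ B i then W i else 0) else 0) / T := by
      intro A
      split_ifs with hA
      · simp only [hQ]; congr 1
        refine Finset.sum_congr rfl fun i _ => ?_
        split_ifs with h1 h2 <;> first | rfl | (subst h1; contradiction)
      · rw [eq_comm, div_eq_zero_iff]; left
        refine Finset.sum_eq_zero fun i _ => ?_
        split_ifs with h1 h2 <;> first | rfl | (subst h1; contradiction)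
    simp_rw [this]
    rw [← Finset.sum_div, Finset.sum_comm]
    simp
  have key := aux_D2 p hp X h0 Q
    (fun A => div_nonneg (Finset.sum_nonneg fun i _ => by split_ifs <;> simp [W0]) Tpos.le)
    (by simp only [hQ]; rw [← Finset.sum_div, Finset.sum_comm]; simp [← hT, Tpos.ne'])
    (by
      intro A hA
      have : (∑ i, if B i = A then W i else 0) ≠ 0 := fun h => hA (by simp [hQ, h])
      obtain ⟨i, -, hi⟩ := Finset.exists_ne_zero_of_sum_ne_zero this
      have : B i = A := by by_contra h; simp [h] at hi
      rw [← this]; exact hB i)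
    (fun z hz => by rw [qq]; exact div_pos (qpos z hz) Tpos)
  simp_rw [qq] at key
  have key2 := hh.trans key
  have hnn : 0 ≤ -∑ z, p z * Real.logb 2 ((∑ i, if z ∈ B i then W i else 0) / T) := by
    rw [← Finset.sum_neg_distrib]
    refine Finset.sum_nonneg fun z _ => ?_
    rcases (hp.1 z).eq_or_lt with h | h
    · simp [← h]
    · have := Real.logb_nonpos (b := 2) (by norm_num) (div_pos (qpos z h) Tpos).le
        ((div_le_one Tpos).2 (qle z))
      nlinarith
  rw [ENNReal.ofReal_le_ofReal_iff hnn] at key2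
  have e : ∑ z, p z * Real.logb 2 ((∑ i, if z ∈ B i then W i else 0) / T) =
      (∑ z, p z * Real.logb 2 (∑ i, if z ∈ B i then W i else 0)) - Real.logb 2 T := by
    rw [show Real.logb 2 T = ∑ z, p z * Real.logb 2 T by rw [← Finset.sum_mul, hp.2, one_mul],
      ← Finset.sum_sub_distrib]
    refine Finset.sum_congr rfl fun z _ => ?_
    rcases (hp.1 z).eq_or_lt with h | h
    · simp [← h]
    · rw [Real.logb_div (qpos z h).ne' Tpos.ne']; ring
  rw [e] at key2
  linarith

lemma aux_sum_cons [Fintype Ω] (n : ℕ) (f : (Fin (n+1) → Ω) → ℝ) :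
    ∑ z, f z = ∑ a, ∑ z : Fin n → Ω, f (Fin.cons a z) := by
  rw [← Fintype.sum_prod_type', ← (Fin.consEquiv fun _ => Ω).sum_comp]
  rfl

lemma aux_pPow_cons [Fintype Ω] (p : Ω → ℝ) (n : ℕ) (a : Ω) (z : Fin n → Ω) :
    pPow p (n+1) (Fin.cons a z : Fin (n+1) → Ω) = p a * pPow p n z := by
  simp [pPow, Fin.prod_univ_succ]

lemma aux_pPow_pmf [Fintype Ω] (p : Ω → ℝ) (hp : IsPMF p) (n : ℕ) : IsPMF (pPow p n) := by
  refine ⟨fun z => Finset.prod_nonneg fun i _ => hp.1 _, ?_⟩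
  induction n with
  | zero => simp [pPow]
  | succ n ih =>
    rw [aux_sum_cons]
    simp_rw [aux_pPow_cons, ← Finset.mul_sum, ih, mul_one]
    exact hp.2

lemma aux_lower [Fintype Ω] (p : Ω → ℝ) (hp : IsPMF p) (X : Finset (Finset Ω))
    (h0 : ∅ ∈ X) (h : ℝ) (hh : ENNReal.ofReal h ≤ Hent p X) {ι : Type*} [Fintype ι] (n : ℕ) :
    ∀ (W : ι → ℝ) (_ : ∀ i, 0 ≤ W i) (B : ι → Fin n → Finset Ω) (_ : ∀ i j, B i j ∈ X)
    (_ : ∀ z, 0 < pPow p n z → 0 < ∑ i, if ∀ j, z j ∈ B i j then W i else 0),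
    n * h - Real.logb 2 (∑ i, W i) ≤
      -(∑ z, pPow p n z * Real.logb 2 (∑ i, if ∀ j, z j ∈ B i j then W i else 0)) := by
  induction n with
  | zero => intro W W0 B hB qpos; simp [pPow]
  | succ n ih =>
    intro W W0 B hB qpos
    set V : Ω → ι → ℝ := fun a i => if a ∈ B i 0 then W i else 0 with hV
    have V0 : ∀ a i, 0 ≤ V a i := fun a i => by simp only [hV]; split_ifs <;> simp [W0]
    have hq : ∀ a (z : Fin n → Ω), (∑ i, if ∀ j, (Fin.cons a z : Fin (n+1) → Ω) j ∈ B i j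
        then W i else 0) = ∑ i, if ∀ j, z j ∈ B i j.succ then V a i else 0 := by
      intro a z
      refine Finset.sum_congr rfl fun i _ => ?_
      simp only [Fin.forall_fin_succ, Fin.cons_zero, Fin.cons_succ, hV]
      by_cases h1 : a ∈ B i 0 <;> simp [h1]
    have hq2 : ∀ a, 0 < p a → ∀ z : Fin n → Ω, 0 < pPow p n z →
        0 < ∑ i, if ∀ j, z j ∈ B i j.succ then V a i else 0 := by
      intro a ha z hz
      rw [← hq]; exact qpos _ (by rw [aux_pPow_cons]; exact mul_pos ha hz)
    have hpn := aux_pPow_pmf p hp n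
    obtain ⟨z0, hz0⟩ : ∃ z, 0 < pPow p n z := by
      by_contra! h
      have := Finset.sum_nonpos (s := Finset.univ) fun A _ => h A
      rw [hpn.2] at this; linarith
    have s1 := aux_D2' p hp X h0 h hh W W0 (fun i => B i 0) (fun i => hB i 0) (by
      intro a ha
      refine (hq2 a ha z0 hz0).trans_le (Finset.sum_le_sum fun i _ => ?_)
      by_cases h1 : ∀ j : Fin n, z0 j ∈ B i j.succ
      · rw [if_pos h1]
      · rw [if_neg h1]; exact V0 a i)
    rw [aux_sum_cons]
    simp_rw [aux_pPow_cons, hq]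
    have s2 : ∀ a, p a * (n * h - Real.logb 2 (∑ i, V a i)) ≤
        -∑ z : Fin n → Ω, p a * pPow p n z *
          Real.logb 2 (∑ i, if ∀ j, z j ∈ B i j.succ then V a i else 0) := by
      intro a
      rcases (hp.1 a).eq_or_lt with h | h
      · simp [← h]
      · simp_rw [mul_assoc]
        rw [← Finset.mul_sum, ← mul_neg]
        exact mul_le_mul_of_nonneg_left
          (ih (V a) (V0 a) (fun i j => B i j.succ) (fun i j => hB i _) (hq2 a h)) h.le
    have s3 := Finset.sum_le_sum fun a (_ : a ∈ Finset.univ) => s2 a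
    rw [Finset.sum_neg_distrib] at s3
    refine le_trans ?_ s3
    simp_rw [mul_sub]
    rw [Finset.sum_sub_distrib, ← Finset.sum_mul, hp.2]
    push_cast
    simp only [hV]
    linarith

lemma aux_mem_inf [Fintype Ω] (X : Finset (Finset Ω)) (n : ℕ) (C : Finset (Fin n → Ω)) :
    C ∈ (Finset.univ.inf fun i : Fin n => embedHyp X n i) ↔
      ∀ i, ∃ A ∈ X, ∀ ω ∈ C, ω i ∈ A := by
  have : C ∈ (Finset.univ.inf fun i : Fin n => embedHyp X n i) ↔
      {C} ≤ (Finset.univ.inf fun i : Fin n => embedHyp X n i) :=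
    Finset.singleton_subset_iff.symm
  rw [this, Finset.le_inf_iff]
  simp [embedHyp]

lemma aux_part1 [Fintype Ω] (p : Ω → ℝ) (hp : IsPMF p) (X : Finset (Finset Ω)) (hX : IsHyp X)
    (n : ℕ) (hn : 0 < n) :
    Hent p X ≤
      Hent (pPow p n) (Finset.univ.inf fun i : Fin n => embedHyp X n i) / (n : ℝ≥0∞) := by
  have h0 : ∅ ∈ X := by
    obtain ⟨A, hA⟩ := hX.1
    exact hX.2 A hA ∅ (by simp)
  refine ENNReal.le_of_forall_nnreal_lt fun r hr => ?_
  rw [ENNReal.le_div_iff_mul_le (by simp [hn.ne']) (by simp)]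
  refine le_iInf₂ fun k hk => ?_
  obtain ⟨Q, Q0, Q1, QY, qpos, hQ⟩ := aux_D1 _ (aux_pPow_pmf p hp n) _ k hk
  have hBex : ∀ (C : Finset (Fin n → Ω)) (j : Fin n), ∃ A ∈ X, Q C ≠ 0 → ∀ ω ∈ C, ω j ∈ A := by
    intro C j
    by_cases hC : Q C = 0
    · exact ⟨∅, h0, fun h => absurd hC h⟩
    · obtain ⟨A, hA, hA'⟩ := (aux_mem_inf X n C).1 (QY C hC) j
      exact ⟨A, hA, fun _ => hA'⟩
  choose B hB hB' using hBex
  have hle : ∀ z : Fin n → Ω, (∑ C, if z ∈ C then Q C else 0) ≤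
      ∑ C, if ∀ j, z j ∈ B C j then Q C else 0 := by
    intro z
    refine Finset.sum_le_sum fun C _ => ?_
    by_cases hC : Q C = 0
    · simp [hC]
    · by_cases hz : z ∈ C
      · rw [if_pos hz, if_pos fun j => hB' C j hC z hz]
      · rw [if_neg hz]; split_ifs <;> simp [Q0]
  have key := aux_lower p hp X h0 r (by simpa using hr.le) n Q Q0 B hB
    (fun z hz => lt_of_lt_of_le (qpos z hz) (le_of_eq_of_le (by congr!) (hle z)))
  rw [Q1, Real.logb_one, sub_zero] at key
  have : (r : ℝ) * n ≤ MI (pPow p n) k := by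
    refine le_trans ?_ hQ
    rw [mul_comm]
    refine key.trans (neg_le_neg (Finset.sum_le_sum fun z _ => ?_))
    rcases ((aux_pPow_pmf p hp n).1 z).eq_or_lt with h | h
    · simp [← h]
    · refine mul_le_mul_of_nonneg_left ?_ h.le
      exact Real.logb_le_logb_of_le (by norm_num) (qpos z h) (by convert hle z)
  have h2 := ENNReal.ofReal_le_ofReal this
  rwa [ENNReal.ofReal_mul r.coe_nonneg, ENNReal.ofReal_natCast, ENNReal.ofReal_coe_nnreal] at h2

lemma aux_rpow (δ a b : ℝ) (hδ : 0 < δ) (hδ1 : δ < 1) (ha : 0 < a) (hb : 0 ≤ b) :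
    (a - b) * a ^ (δ - 1) + b ^ δ / δ ≤ a ^ δ / δ := by
  have h1 := rpow_one_add_le_one_add_mul_self (s := b / a - 1) (p := δ)
    (by have := div_nonneg hb ha.le; linarith) hδ.le hδ1.le
  rw [show 1 + (b / a - 1) = b / a by ring, Real.div_rpow hb ha.le] at h1
  have hap : 0 < a ^ δ := Real.rpow_pos_of_pos ha δ
  rw [div_le_iff₀ hap] at h1
  rw [Real.rpow_sub_one ha.ne']
  rw [← sub_nonneg]
  have : a ^ δ / δ - ((a - b) * (a ^ δ / a) + b ^ δ / δ) =
    ((1 + δ * (b / a - 1)) * a ^ δ - b ^ δ) / δ := by field_simp; ring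
  rw [this]
  exact div_nonneg (by linarith) hδ.le

lemma aux_greedy {α : Type*} [Fintype α] (p q : α → ℝ) (Y : Finset (Finset α))
    (hY : ∀ A ∈ Y, ∀ B ⊆ A, B ∈ Y)
    (δ : ℝ) (hδ : 0 < δ) (hδ1 : δ < 1)
    (hav : ∀ R : Finset α, ∃ A ∈ Y, ∑ z ∈ R, p z * q z ≤ ∑ z ∈ A ∩ R, p z)
    (R : Finset α) : (∀ z ∈ R, 0 < p z ∧ 0 < q z) →
    ∃ c : α → Finset α, (∀ z ∈ R, z ∈ c z ∧ c z ⊆ R ∧ c z ∈ Y) ∧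
      (∀ z ∈ R, ∀ w ∈ c z, c w = c z) ∧
      ∑ z ∈ R, p z * (q z * (∑ w ∈ c z, p w) ^ (δ - 1)) ≤ (∑ z ∈ R, p z * q z) ^ δ / δ := by
  induction R using Finset.strongInduction with
  | H R ih =>
  intro hpos
  rcases R.eq_empty_or_nonempty with rfl | hne
  · exact ⟨fun _ => ∅, by simp, by simp, by simp [Real.zero_rpow hδ.ne']⟩
  have tpos : 0 < ∑ z ∈ R, p z * q z :=
    Finset.sum_pos (fun z hz => mul_pos (hpos z hz).1 (hpos z hz).2) hne
  obtain ⟨A, hA, hAt⟩ := hav R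
  set C := A ∩ R with hC
  have hCR : C ⊆ R := Finset.inter_subset_right
  have hCY : C ∈ Y := hY A hA C Finset.inter_subset_left
  have hCne : C.Nonempty := by
    by_contra h
    rw [Finset.not_nonempty_iff_eq_empty] at h
    rw [h, Finset.sum_empty] at hAt; linarith
  have hss : R \ C ⊂ R := Finset.sdiff_ssubset hCR hCne
  obtain ⟨c, c1, c2, c3⟩ := ih (R \ C) hss fun z hz => hpos z (hss.1 hz)
  refine ⟨fun z => if z ∈ C then C else c z, ?_, ?_, ?_⟩
  · intro z hz
    by_cases h : z ∈ C
    · simp only [h, if_true]; exact ⟨trivial, hCR, hCY⟩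
    · simp only [h, if_false]
      obtain ⟨h1, h2, h3⟩ := c1 z (Finset.mem_sdiff.2 ⟨hz, h⟩)
      exact ⟨h1, h2.trans hss.1, h3⟩
  · intro z hz w hw
    by_cases h : z ∈ C
    · simp only [h, if_true] at hw ⊢; simp [hw]
    · simp only [h, if_false] at hw ⊢
      have hz' := Finset.mem_sdiff.2 ⟨hz, h⟩
      have := (Finset.mem_sdiff.1 ((c1 z hz').2.1 hw)).2
      simp only [this, if_false]
      exact c2 z hz' w hw
  · rw [← Finset.sum_sdiff hCR]
    have e1 : ∑ z ∈ R \ C, p z * (q z * (∑ w ∈ (if z ∈ C then C else c z), p w) ^ (δ - 1)) =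
        ∑ z ∈ R \ C, p z * (q z * (∑ w ∈ c z, p w) ^ (δ - 1)) :=
      Finset.sum_congr rfl fun z hz => by rw [if_neg (Finset.mem_sdiff.1 hz).2]
    have e2 : ∑ z ∈ C, p z * (q z * (∑ w ∈ (if z ∈ C then C else c z), p w) ^ (δ - 1)) =
        (∑ z ∈ C, p z * q z) * (∑ w ∈ C, p w) ^ (δ - 1) := by
      rw [Finset.sum_mul]
      exact Finset.sum_congr rfl fun z hz => by rw [if_pos hz]; ring
    rw [e1, e2]
    have hC0 : 0 ≤ ∑ z ∈ C, p z * q z :=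
      Finset.sum_nonneg fun z hz => (mul_pos (hpos z (hCR hz)).1 (hpos z (hCR hz)).2).le
    have hR0 : 0 ≤ ∑ z ∈ R \ C, p z * q z :=
      Finset.sum_nonneg fun z hz => (mul_pos (hpos z (hss.1 hz)).1 (hpos z (hss.1 hz)).2).le
    have hs := Finset.sum_sdiff (f := fun z => p z * q z) hCR
    have m1 : (∑ w ∈ C, p w) ^ (δ - 1) ≤ (∑ z ∈ R, p z * q z) ^ (δ - 1) :=
      Real.rpow_le_rpow_of_nonpos tpos hAt (by linarith)
    have m2 := mul_le_mul_of_nonneg_left m1 hC0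
    have m3 := aux_rpow δ _ _ hδ hδ1 tpos hR0
    have m4 : ∑ z ∈ R, p z * q z - ∑ z ∈ R \ C, p z * q z = ∑ z ∈ C, p z * q z := by
      linarith
    rw [m4] at m3
    linarith

lemma aux_oi {α : Type*} [Fintype α] (p q : α → ℝ) (hp : IsPMF p) (Y : Finset (Finset α))
    (hY : ∀ A ∈ Y, ∀ B ⊆ A, B ∈ Y)
    (δ : ℝ) (hδ : 0 < δ) (hδ1 : δ < 1)
    (hav : ∀ R : Finset α, ∃ A ∈ Y, ∑ z ∈ R, p z * q z ≤ ∑ z ∈ A ∩ R, p z)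
    (qpos : ∀ z, 0 < p z → 0 < q z) :
    ∃ M : Finset (Finset α), IsOI M ∧ M ⊆ Y ∧ Hent p M ≤
      ENNReal.ofReal ((-(∑ z, p z * Real.logb 2 (q z)) + Real.logb 2 (1 / δ)) / (1 - δ)) := by
  set R := Finset.univ.filter fun z => 0 < p z with hR
  have memR : ∀ z, z ∈ R ↔ 0 < p z := fun z => by simp [hR]
  obtain ⟨c, c1, c2, c3⟩ := aux_greedy p q Y hY δ hδ hδ1 hav R
    fun z hz => ⟨(memR z).1 hz, qpos z ((memR z).1 hz)⟩
  obtain ⟨z0, hz0⟩ : ∃ z, 0 < p z := by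
    by_contra! h
    have := Finset.sum_nonpos (s := Finset.univ) fun A _ => h A
    rw [hp.2] at this; linarith
  have hz0R := (memR z0).2 hz0
  have sumR : ∀ f : α → ℝ, ∑ z, p z * f z = ∑ z ∈ R, p z * f z := by
    intro f
    rw [eq_comm]
    refine Finset.sum_subset (Finset.subset_univ _) fun z _ hz => ?_
    have : p z = 0 := le_antisymm (not_lt.1 fun h => hz ((memR z).2 h)) (hp.1 z)
    simp [this]
  have pR : ∑ z ∈ R, p z = 1 := by
    have := sumR fun _ => 1
    simp only [mul_one] at this
    rw [← this, hp.2]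
  have gpos : ∀ z ∈ R, 0 < ∑ w ∈ c z, p w := fun z hz =>
    Finset.sum_pos (fun w hw => (memR w).1 ((c1 z hz).2.1 hw)) ⟨z, (c1 z hz).1⟩
  refine ⟨Finset.univ.filter fun C => ∃ A ∈ R.image c, C ⊆ A, ⟨R.image c, ⟨c z0, ?_⟩, ?_, ?_⟩,
    ?_, ?_⟩
  · exact Finset.mem_image_of_mem _ hz0R
  · intro A hA B hB hAB
    obtain ⟨z, hz, rfl⟩ := Finset.mem_image.1 hA
    obtain ⟨w, hw, rfl⟩ := Finset.mem_image.1 hB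
    rw [Finset.disjoint_left]
    intro x hx hx'
    exact hAB ((c2 z hz x hx).symm.trans (c2 w hw x hx'))
  · intro C; simp
  · intro C hC
    obtain ⟨A, hA, hCA⟩ := (Finset.mem_filter.1 hC).2
    obtain ⟨z, hz, rfl⟩ := Finset.mem_image.1 hA
    exact hY _ (c1 z hz).2.2 C hCA
  · set k : α → Finset α → ℝ := fun z A =>
      if A = (if 0 < p z then c z else c z0) then 1 else 0 with hk
    have kv : ValidK p (Finset.univ.filter fun C => ∃ A ∈ R.image c, C ⊆ A) k := by
      refine ⟨fun z A => by simp only [hk]; split_ifs <;> simp, fun z => by simp [hk], ?_, ?_⟩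
      · intro z A h
        have hA : A = (if 0 < p z then c z else c z0) := by
          by_contra h'; simp only [hk, if_neg h'] at h; exact lt_irrefl _ h
        refine Finset.mem_filter.2 ⟨Finset.mem_univ _, A, ?_, subset_rfl⟩
        rw [hA]
        split_ifs with h1
        · exact Finset.mem_image_of_mem _ ((memR z).2 h1)
        · exact Finset.mem_image_of_mem _ hz0R
      · intro z A hz h
        have hA : A = (if 0 < p z then c z else c z0) := by
          by_contra h'; simp only [hk, if_neg h'] at h; exact lt_irrefl _ h
        rw [hA, if_pos hz]; exact (c1 z ((memR z).2 hz)).1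
    refine (iInf₂_le k kv).trans (ENNReal.ofReal_le_ofReal ?_)
    have hmarg : ∀ z ∈ R, ∑ z', p z' * k z' (c z) = ∑ w ∈ c z, p w := by
      intro z hz
      rw [sumR]
      rw [← Finset.sum_subset (c1 z hz).2.1 (f := fun z' => p z' * k z' (c z))]
      · refine Finset.sum_congr rfl fun w hw => ?_
        have := (memR w).1 ((c1 z hz).2.1 hw)
        simp [hk, this, c2 z hz w hw]
      · intro w hw hwc
        have hne : c z ≠ c w := fun h => hwc (by rw [h]; exact (c1 w hw).1)
        simp [hk, (memR w).1 hw, hne]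
    have hMI : MI p k = -∑ z ∈ R, p z * Real.logb 2 (∑ w ∈ c z, p w) := by
      unfold MI
      simp_rw [mul_assoc, ← Finset.mul_sum]
      rw [sumR, ← Finset.sum_neg_distrib]
      refine Finset.sum_congr rfl fun z hz => ?_
      have hkz : ∀ A, k z A = if A = c z then 1 else 0 := fun A => by
        simp [hk, (memR z).1 hz]
      rw [Finset.sum_eq_single (c z)]
      · rw [hmarg z hz, hkz, if_pos rfl, one_mul, one_div, Real.logb_inv]; ring
      · intro A _ hA; simp [hkz, hA]
      · simp
    rw [hMI, sumR, le_div_iff₀ (by linarith)]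
    have t1 : ∑ z ∈ R, p z * q z ≤ 1 := by
      obtain ⟨A, hA, hAt⟩ := hav R
      refine hAt.trans ?_
      rw [← pR]
      exact Finset.sum_le_sum_of_subset_of_nonneg Finset.inter_subset_right fun z _ _ => hp.1 z
    have t0 : 0 ≤ ∑ z ∈ R, p z * q z :=
      Finset.sum_nonneg fun z hz => mul_nonneg (hp.1 z) (qpos z ((memR z).1 hz)).le
    have hj := aux_jensen R p (fun z => q z * (∑ w ∈ c z, p w) ^ (δ - 1)) (fun z _ => hp.1 z) pR
      (fun z hz h => mul_pos (qpos z h) (Real.rpow_pos_of_pos (gpos z hz) _)) (1 / δ)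
      (c3.trans (by
        gcongr
        exact Real.rpow_le_one t0 t1 hδ.le)) (by positivity)
    have e : ∑ z ∈ R, p z * Real.logb 2 (q z * (∑ w ∈ c z, p w) ^ (δ - 1)) =
        ∑ z ∈ R, p z * Real.logb 2 (q z) +
          (δ - 1) * ∑ z ∈ R, p z * Real.logb 2 (∑ w ∈ c z, p w) := by
      rw [Finset.mul_sum, ← Finset.sum_add_distrib]
      refine Finset.sum_congr rfl fun z hz => ?_
      rw [Real.logb_mul (qpos z ((memR z).1 hz)).ne' (Real.rpow_pos_of_pos (gpos z hz) _).ne',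
        Real.logb_rpow_eq_mul_logb_of_pos (gpos z hz)]
      ring
    rw [e] at hj
    linarith

lemma aux_prod_log [Fintype Ω] (p q : Ω → ℝ) (hp : IsPMF p) (qpos : ∀ z, 0 < p z → 0 < q z)
    (n : ℕ) : ∑ z : Fin n → Ω, pPow p n z * Real.logb 2 (∏ i, q (z i)) =
      n * ∑ z, p z * Real.logb 2 (q z) := by
  induction n with
  | zero => simp
  | succ n ih =>
    rw [aux_sum_cons]
    have e : ∀ a (z : Fin n → Ω), pPow p (n+1) (Fin.cons a z : Fin (n+1) → Ω) *
        Real.logb 2 (∏ i, q ((Fin.cons a z : Fin (n+1) → Ω) i)) =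
        pPow p n z * (p a * Real.logb 2 (q a)) +
          p a * (pPow p n z * Real.logb 2 (∏ i, q (z i))) := by
      intro a z
      rw [aux_pPow_cons, Fin.prod_univ_succ]
      simp only [Fin.cons_zero, Fin.cons_succ]
      rcases (hp.1 a).eq_or_lt with h | h
      · simp [← h]
      rcases ((aux_pPow_pmf p hp n).1 z).eq_or_lt with h' | h'
      · simp [← h']
      have : ∏ i, q (z i) ≠ 0 := by
        refine Finset.prod_ne_zero_iff.2 fun i _ => (qpos _ ?_).ne'
        refine lt_of_le_of_ne (hp.1 _) fun h0 => h'.ne' ?_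
        exact Finset.prod_eq_zero (Finset.mem_univ i) h0.symm
      rw [Real.logb_mul (qpos a h).ne' this]; ring
    simp_rw [e, Finset.sum_add_distrib, ← Finset.mul_sum, ← Finset.sum_mul, ih,
      (aux_pPow_pmf p hp n).2, hp.2]
    push_cast; ring

lemma aux_part2 [Fintype Ω] (p : Ω → ℝ) (hp : IsPMF p) (X : Finset (Finset Ω)) (hX : IsHyp X)
    (k : Ω → Finset Ω → ℝ) (hk : ValidK p X k) (n : ℕ) (δ : ℝ) (hδ : 0 < δ) (hδ1 : δ < 1) :
    (⨅ (M : Finset (Finset (Fin n → Ω)))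
          (_ : IsOI M ∧ M ⊆ Finset.univ.inf fun i : Fin n => embedHyp X n i),
          Hent (pPow p n) M) ≤
      ENNReal.ofReal ((n * MI p k + Real.logb 2 (1 / δ)) / (1 - δ)) := by
  obtain ⟨Q, Q0, Q1, QX, qpos, hQ⟩ := aux_D1 p hp X k hk
  set q : Ω → ℝ := fun z => ∑ A, if z ∈ A then Q A else 0 with hq
  have q0 : ∀ z, 0 ≤ q z := fun z => Finset.sum_nonneg fun A _ => by split_ifs <;> simp [Q0]
  obtain ⟨M, hM1, hM2, hM3⟩ := aux_oi (pPow p n) (fun z => ∏ i, q (z i)) (aux_pPow_pmf p hp n)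
    (Finset.univ.inf fun i : Fin n => embedHyp X n i)
    (by
      intro A hA B hB
      rw [aux_mem_inf] at hA ⊢
      intro i
      obtain ⟨D, hD, hD'⟩ := hA i
      exact ⟨D, hD, fun ω hω => hD' ω (hB hω)⟩) δ hδ hδ1
    (by
      intro R
      have hprod : ∀ z : Fin n → Ω, ∏ i, q (z i) =
          ∑ A : Fin n → Finset Ω, if ∀ i, z i ∈ A i then ∏ i, Q (A i) else 0 := by
        intro z
        simp only [hq]
        rw [Finset.prod_univ_sum, Fintype.piFinset_univ]
        refine Finset.sum_congr rfl fun A _ => ?_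
        split_ifs with h
        · exact Finset.prod_congr rfl fun i _ => by rw [if_pos (h i)]
        · push Not at h
          obtain ⟨i, hi⟩ := h
          exact Finset.prod_eq_zero (Finset.mem_univ i) (by rw [if_neg hi])
      have hQn : ∑ A : Fin n → Finset Ω, ∏ i, Q (A i) = 1 := by
        have := Finset.prod_univ_sum (fun _ : Fin n => (Finset.univ : Finset (Finset Ω)))
          (fun _ A => Q A)
        rw [Fintype.piFinset_univ] at this
        rw [← this]; simp [Q1]
      set t := ∑ z ∈ R, pPow p n z * ∏ i, q (z i) with ht
      have hP : ∀ A : Fin n → Finset Ω, 0 ≤ ∏ i, Q (A i) := fun A =>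
        Finset.prod_nonneg fun i _ => Q0 _
      have hex : ∃ A : Fin n → Finset Ω, 0 < ∏ i, Q (A i) ∧
          t ≤ ∑ z ∈ R, if ∀ i, z i ∈ A i then pPow p n z else 0 := by
        by_contra! hcon
        have ht2 : t = ∑ A : Fin n → Finset Ω, (∏ i, Q (A i)) *
            ∑ z ∈ R, if ∀ i, z i ∈ A i then pPow p n z else 0 := by
          rw [ht]
          simp_rw [hprod, Finset.mul_sum]
          rw [Finset.sum_comm]
          refine Finset.sum_congr rfl fun A _ => Finset.sum_congr rfl fun z _ => ?_
          split_ifs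
          · ring
          · simp
        have ht3 : t = ∑ A : Fin n → Finset Ω, (∏ i, Q (A i)) * t := by
          rw [← Finset.sum_mul, hQn, one_mul]
        have hlt : ∑ A : Fin n → Finset Ω, (∏ i, Q (A i)) *
            (∑ z ∈ R, if ∀ i, z i ∈ A i then pPow p n z else 0) <
            ∑ A : Fin n → Finset Ω, (∏ i, Q (A i)) * t := by
          refine Finset.sum_lt_sum (fun A _ => ?_) ?_
          · rcases (hP A).eq_or_lt with h | h
            · simp [← h]
            · exact mul_le_mul_of_nonneg_left (hcon A h).le h.le
          · have : ∃ A : Fin n → Finset Ω, 0 < ∏ i, Q (A i) := by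
              by_contra! h
              have := Finset.sum_nonpos (s := Finset.univ) fun A _ => h A
              rw [hQn] at this; linarith
            obtain ⟨A, hA⟩ := this
            exact ⟨A, Finset.mem_univ _, mul_lt_mul_of_pos_left (hcon A hA) hA⟩
        rw [← ht2, ← ht3] at hlt
        exact lt_irrefl _ hlt
      obtain ⟨A, hA, hAt⟩ := hex
      refine ⟨Finset.univ.filter fun z => ∀ i, z i ∈ A i, ?_, ?_⟩
      · rw [aux_mem_inf]
        intro i
        refine ⟨A i, QX _ fun h => hA.ne' (Finset.prod_eq_zero (Finset.mem_univ i) h), ?_⟩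
        intro ω hω
        exact (Finset.mem_filter.1 hω).2 i
      · refine hAt.trans (le_of_eq ?_)
        rw [← Finset.sum_filter]
        refine Finset.sum_congr ?_ fun _ _ => rfl
        ext z; simp [and_comm])
    (by
      intro z hz
      refine Finset.prod_pos fun i _ => qpos _ ?_
      refine lt_of_le_of_ne (hp.1 _) fun h0 => hz.ne' ?_
      exact Finset.prod_eq_zero (Finset.mem_univ i) h0.symm)
  refine (iInf₂_le M ⟨hM1, hM2⟩).trans (hM3.trans (ENNReal.ofReal_le_ofReal ?_))
  rw [aux_prod_log p q hp qpos n]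
  have h1 : 0 < 1 - δ := by linarith
  have h2 : -(n * ∑ z, p z * Real.logb 2 (q z)) ≤ n * MI p k := by
    rw [← mul_neg]
    exact mul_le_mul_of_nonneg_left hQ (Nat.cast_nonneg n)
  gcongr

lemma aux_mono {α : Type*} [Fintype α] (p : α → ℝ) (M Y : Finset (Finset α)) (h : M ⊆ Y) :
    Hent p Y ≤ Hent p M :=
  le_iInf₂ fun k hk => iInf₂_le k ⟨hk.1, hk.2.1, fun z A hA => h (hk.2.2.1 z A hA), hk.2.2.2⟩

lemma aux_lim (I : ℝ) : Filter.Tendsto (fun n : ℕ =>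
    ((n * I + Real.logb 2 (1 / (1 / (n : ℝ)))) / (1 - 1 / (n : ℝ))) / n) Filter.atTop (nhds I) := by
  have h1 : Filter.Tendsto (fun n : ℕ => 1 / (n : ℝ)) Filter.atTop (nhds 0) :=
    tendsto_one_div_atTop_nhds_zero_nat
  have h2 : Filter.Tendsto (fun n : ℕ => Real.log (n : ℝ) / n) Filter.atTop (nhds 0) := by
    have := (Real.isLittleO_log_id_atTop.tendsto_div_nhds_zero).comp
      (tendsto_natCast_atTop_atTop (R := ℝ))
    exact this
  have h3 := ((h2.div_const (Real.log 2)).const_add I).div (h1.const_sub 1) (by norm_num)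
  simp only [zero_div, add_zero, sub_zero, div_one] at h3
  refine h3.congr' ?_
  filter_upwards [Filter.eventually_gt_atTop 1] with n hn
  have hn' : (1 : ℝ) < n := by exact_mod_cast hn
  have h4 : (n : ℝ) - 1 ≠ 0 := by linarith
  have h5 : (n : ℝ) ≠ 0 := by linarith
  have h6 : Real.log 2 ≠ 0 := (Real.log_pos (by norm_num)).ne'
  have h7 : (1 : ℝ) - 1 / n ≠ 0 := by
    rw [one_sub_div h5]; exact div_ne_zero h4 h5
  simp only [Pi.div_apply, one_div_one_div, Real.logb]
  field_simp

/-- **Conjunctive source coding theorem.**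
`lim_n H(∩ᵢ Xᵢ)/n = H(X)` and `lim_n (1/n) min_{M ∈ OIs, M ⊆ ∩ᵢ Xᵢ} H(M) = H(X)`,
where `X₁, …, Xₙ` is the `n`-fold i.i.d. hyperconfusion sequence of `X`. -/
theorem stmt10 [Fintype Ω] (p : Ω → ℝ) (hp : IsPMF p)
    (X : Finset (Finset Ω)) (hX : IsHyp X) :
    Filter.Tendsto
      (fun n : ℕ =>
        Hent (pPow p n) (Finset.univ.inf fun i : Fin n => embedHyp X n i) / (n : ℝ≥0∞))
      Filter.atTop (nhds (Hent p X)) ∧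
    Filter.Tendsto
      (fun n : ℕ =>
        (⨅ (M : Finset (Finset (Fin n → Ω)))
          (_ : IsOI M ∧ M ⊆ Finset.univ.inf fun i : Fin n => embedHyp X n i),
          Hent (pPow p n) M) / (n : ℝ≥0∞))
      Filter.atTop (nhds (Hent p X)) := by
  set F1 := fun n : ℕ =>
    Hent (pPow p n) (Finset.univ.inf fun i : Fin n => embedHyp X n i) / (n : ℝ≥0∞) with hF1
  set F2 := fun n : ℕ =>
    (⨅ (M : Finset (Finset (Fin n → Ω)))
      (_ : IsOI M ∧ M ⊆ Finset.univ.inf fun i : Fin n => embedHyp X n i),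
      Hent (pPow p n) M) / (n : ℝ≥0∞) with hF2
  have h12 : ∀ n, F1 n ≤ F2 n := fun n =>
    ENNReal.div_le_div_right (le_iInf₂ fun M hM => aux_mono _ _ _ hM.2) _
  have hlow : ∀ᶠ n in Filter.atTop, Hent p X ≤ F1 n := by
    filter_upwards [Filter.eventually_gt_atTop 0] with n hn
    exact aux_part1 p hp X hX n hn
  have hup : ∀ b, Hent p X < b → ∀ᶠ n in Filter.atTop, F2 n < b := by
    intro b hb
    obtain ⟨k, hk⟩ := iInf_lt_iff.1 hb
    obtain ⟨hkv, hk⟩ := iInf_lt_iff.1 hk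
    have hl := (ENNReal.tendsto_ofReal (aux_lim (MI p k))).eventually (gt_mem_nhds hk)
    filter_upwards [hl, Filter.eventually_gt_atTop 1] with n hn hn1
    have hn' : (1 : ℝ) < n := by exact_mod_cast hn1
    have hn0 : (0 : ℝ) < n := by linarith
    refine lt_of_le_of_lt ?_ hn
    rw [ENNReal.ofReal_div_of_pos hn0, ENNReal.ofReal_natCast]
    exact ENNReal.div_le_div_right (aux_part2 p hp X hX k hkv n (1 / n) (by positivity)
      ((div_lt_one hn0).2 hn')) _
  constructor
  · rw [tendsto_order]
    refine ⟨fun a ha => ?_, fun b hb => ?_⟩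
    · filter_upwards [hlow] with n hn using ha.trans_le hn
    · filter_upwards [hup b hb] with n hn using (h12 n).trans_lt hn
  · rw [tendsto_order]
    refine ⟨fun a ha => ?_, fun b hb => hup b hb⟩
    filter_upwards [hlow] with n hn using ha.trans_le (hn.trans (h12 n))

end
end

section
/- Let X, Y be hyperconfusions over a finite probability space (Ω, p). Then: (i) 0 ≤ H(X|Y) ≤ H(X); (ii) H(X|2^Ω) = H(X) and H(X|{∅}) = 0; (iii) H(X|Y) + H(Y) = H(X ∩ Y) (with the convention c + ∞ = ∞); (iv) if Y ∈ OIs(Ω) then H(X|Y) = Σ_{E ∈ maxs(Y)} p(E) · H(X|E); in particular, for any E ⊆ Ω, H(X|2^E) = p(E) · H(X|E). -/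
open Finset
open scoped Classical ENNReal

noncomputable section

variable {Ω : Type*}

section helpers

/-- `q` is a pmf on the family `X`. -/
def IsQ [Fintype Ω] (X : Finset (Finset Ω)) (q : Finset Ω → ℝ) : Prop :=
  (∀ A, 0 ≤ q A) ∧ (∀ A, q A ≠ 0 → A ∈ X) ∧ ∑ A : Finset Ω, q A = 1

/-- The probability that a `q`-random set contains `z`. -/
def Qz [Fintype Ω] (q : Finset Ω → ℝ) (z : Ω) : ℝ := ∑ A : Finset Ω, if z ∈ A then q A else 0

/-- The cost of `q` with respect to the weight `w`. -/
def Gcost [Fintype Ω] (w : Ω → ℝ) (q : Finset Ω → ℝ) : ℝ≥0∞ :=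
  ∑ z : Ω, ENNReal.ofReal (w z) * negLog2 (Qz q z)

/-- The variational form of the entropy. -/
def Gent [Fintype Ω] (w : Ω → ℝ) (X : Finset (Finset Ω)) : ℝ≥0∞ :=
  ⨅ (q : Finset Ω → ℝ) (_ : IsQ X q), Gcost w q

/-- restriction of a weight to an event. -/
def restr (p : Ω → ℝ) (E : Finset Ω) : Ω → ℝ := fun z => if z ∈ E then p z else 0

lemma negLog2_pos {x : ℝ} (h : 0 < x) : negLog2 x = ENNReal.ofReal (Real.logb 2 x⁻¹) := by
  simp [negLog2, not_le.mpr h]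

lemma negLog2_nonpos {x : ℝ} (h : x ≤ 0) : negLog2 x = ⊤ := by
  simp [negLog2, h]

lemma negLog2_one : negLog2 1 = 0 := by
  rw [negLog2_pos one_pos]; simp

lemma negLog2_anti {a b : ℝ} (h : a ≤ b) : negLog2 b ≤ negLog2 a := by
  rcases le_or_gt a 0 with ha | ha
  · rw [negLog2_nonpos ha]; exact le_top
  · rw [negLog2_pos ha, negLog2_pos (ha.trans_le h)]
    apply ENNReal.ofReal_le_ofReal
    rw [Real.logb_inv, Real.logb_inv]
    exact neg_le_neg (Real.logb_le_logb_of_le (by norm_num) ha h)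

lemma logb_inv_nonneg {a : ℝ} (h0 : 0 ≤ a) (h1 : a ≤ 1) : 0 ≤ Real.logb 2 a⁻¹ := by
  rw [Real.logb_inv]
  have := Real.logb_nonpos (b := 2) (by norm_num) h0 h1
  linarith

lemma negLog2_mul {a b : ℝ} (ha : 0 ≤ a) (ha1 : a ≤ 1) (hb : 0 ≤ b) (hb1 : b ≤ 1) :
    negLog2 (a * b) = negLog2 a + negLog2 b := by
  rcases ha.eq_or_lt with rfl | ha
  · simp [negLog2]
  rcases hb.eq_or_lt with rfl | hb
  · simp [negLog2]
  rw [negLog2_pos ha, negLog2_pos hb, negLog2_pos (mul_pos ha hb),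
    ← ENNReal.ofReal_add (logb_inv_nonneg ha.le ha1) (logb_inv_nonneg hb.le hb1)]
  congr 1
  rw [mul_inv, Real.logb_mul (by positivity) (by positivity)]

lemma gibbs_term {a b : ℝ} (ha : 0 ≤ a) (hb : 0 ≤ b) (hab : 0 < a → 0 < b) :
    a * Real.logb 2 (b / a) ≤ (b - a) / Real.log 2 := by
  have hl : 0 < Real.log 2 := Real.log_pos (by norm_num)
  rcases ha.eq_or_lt with rfl | ha
  · simp; positivity
  · rw [Real.logb, ← mul_div_assoc]
    apply div_le_div_of_nonneg_right _ hl.le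
    have := Real.log_le_sub_one_of_pos (div_pos (hab ha) ha)
    calc a * Real.log (b / a) ≤ a * (b / a - 1) := mul_le_mul_of_nonneg_left this ha.le
      _ = b - a := by field_simp

lemma gibbs {ι : Type*} (s : Finset ι) (a b : ι → ℝ) (ha : ∀ i ∈ s, 0 ≤ a i)
    (hb : ∀ i ∈ s, 0 ≤ b i)
    (hab : ∀ i ∈ s, 0 < a i → 0 < b i) (hs : ∑ i ∈ s, b i ≤ ∑ i ∈ s, a i) :
    ∑ i ∈ s, a i * Real.logb 2 (b i / a i) ≤ 0 := by
  have hl : 0 < Real.log 2 := Real.log_pos (by norm_num)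
  calc _ ≤ ∑ i ∈ s, (b i - a i) / Real.log 2 :=
        Finset.sum_le_sum fun i hi => gibbs_term (ha i hi) (hb i hi) (hab i hi)
    _ = (∑ i ∈ s, b i - ∑ i ∈ s, a i) / Real.log 2 := by
        rw [← Finset.sum_div, Finset.sum_sub_distrib]
    _ ≤ 0 := div_nonpos_of_nonpos_of_nonneg (by linarith) hl.le

variable [Fintype Ω]

lemma Qz_nonneg {q : Finset Ω → ℝ} (h : ∀ A, 0 ≤ q A) (z : Ω) : 0 ≤ Qz q z :=
  Finset.sum_nonneg fun A _ => by split_ifs <;> simp [h]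

lemma Qz_le_one {X : Finset (Finset Ω)} {q : Finset Ω → ℝ} (h : IsQ X q) (z : Ω) :
    Qz q z ≤ 1 := by
  rw [← h.2.2]
  exact Finset.sum_le_sum fun A _ => by split_ifs <;> simp [h.1]

/-- real form of cost. -/
lemma cost_eq {w : Ω → ℝ} (hw : ∀ z, 0 ≤ w z) {Q : Ω → ℝ} (h0 : ∀ z, 0 ≤ Q z) (h1 : ∀ z, Q z ≤ 1)
    (hpos : ∀ z, 0 < w z → 0 < Q z) (s : Finset Ω) :
    ∑ z ∈ s, ENNReal.ofReal (w z) * negLog2 (Q z)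
      = ENNReal.ofReal (∑ z ∈ s, w z * Real.logb 2 (Q z)⁻¹) := by
  rw [ENNReal.ofReal_sum_of_nonneg
    (fun z _ => mul_nonneg (hw z) (logb_inv_nonneg (h0 z) (h1 z)))]
  apply Finset.sum_congr rfl
  intro z _
  rcases (hw z).eq_or_lt with h | h
  · simp [← h]
  · rw [negLog2_pos (hpos z h), ENNReal.ofReal_mul h.le]

lemma G_le {w : Ω → ℝ} {X : Finset (Finset Ω)} {q : Finset Ω → ℝ} (h : IsQ X q) :
    Gent w X ≤ Gcost w q := iInf₂_le q h

lemma G_le_push {ι : Type*} [Fintype ι] (w : Ω → ℝ) (X : Finset (Finset Ω)) (c : ι → ℝ)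
    (f : ι → Finset Ω) (h0 : ∀ i, 0 ≤ c i) (h1 : ∑ i, c i = 1) (hf : ∀ i, c i ≠ 0 → f i ∈ X) :
    Gent w X ≤ ∑ z, ENNReal.ofReal (w z) * negLog2 (∑ i, if z ∈ f i then c i else 0) := by
  have hq : IsQ X (fun B => ∑ i, if f i = B then c i else 0) := by
    refine ⟨fun A => Finset.sum_nonneg fun i _ => by split_ifs <;> simp [h0], ?_, ?_⟩
    · intro A hA
      obtain ⟨i, -, hi⟩ := Finset.exists_ne_zero_of_sum_ne_zero hA
      by_cases h : f i = A
      · rw [if_pos h] at hi; rw [← h]; exact hf i hi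
      · simp [h] at hi
    · rw [Finset.sum_comm]; simpa using h1
  refine (G_le hq).trans (le_of_eq ?_)
  unfold Gcost
  apply Finset.sum_congr rfl
  intro z _
  congr 2
  unfold Qz
  have : ∀ A : Finset Ω, (if z ∈ A then ∑ i, (if f i = A then c i else 0) else 0)
      = ∑ i, if f i = A then (if z ∈ A then c i else 0) else 0 := by
    intro A
    split_ifs <;> simp
  simp_rw [this]
  rw [Finset.sum_comm]
  simp

lemma Hent_eq_G (p : Ω → ℝ) (hp : IsPMF p) (X : Finset (Finset Ω)) :
    Hent p X = Gent p X := by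
  apply le_antisymm
  · refine le_iInf₂ fun q hq => ?_
    by_cases hfin : ∀ z, 0 < p z → 0 < Qz q z
    swap
    · push Not at hfin
      obtain ⟨z, hz, hQ⟩ := hfin
      have : Gcost p q = ⊤ := by
        unfold Gcost
        rw [ENNReal.sum_eq_top]
        refine ⟨z, Finset.mem_univ z, ?_⟩
        rw [negLog2_nonpos hQ]
        exact ENNReal.mul_top (by simpa using hz)
      rw [this]; exact le_top
    set k : Ω → Finset Ω → ℝ := fun z A =>
      if 0 < Qz q z then (if z ∈ A then q A / Qz q z else 0) else q A with hk
    have hk0 : ∀ z A, 0 ≤ k z A := by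
      intro z A
      simp only [hk]
      split_ifs with h1 h2
      · exact div_nonneg (hq.1 A) h1.le
      · exact le_rfl
      · exact hq.1 A
    have hk1 : ∀ z, ∑ A, k z A = 1 := by
      intro z
      by_cases h : 0 < Qz q z
      · have : ∀ A, k z A = (if z ∈ A then q A else 0) / Qz q z := by
          intro A; simp only [hk, if_pos h]; split_ifs <;> simp
        simp_rw [this]
        rw [← Finset.sum_div]
        exact div_self h.ne'
      · simp only [hk, if_neg h]; exact hq.2.2
    have hkq : ∀ z A, 0 < k z A → 0 < q A := by
      intro z A h
      refine lt_of_le_of_ne (hq.1 A) fun h0 => ?_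
      simp [hk, ← h0] at h
    have hv : ValidK p X k := by
      refine ⟨hk0, hk1, fun z A h => hq.2.1 A (hkq z A h).ne', ?_⟩
      intro z A hz h
      by_contra hA
      simp [hk, hfin z hz, hA] at h
    refine (iInf₂_le k hv).trans ?_
    unfold Gcost
    rw [cost_eq hp.1 (Qz_nonneg hq.1) (Qz_le_one hq) hfin]
    apply ENNReal.ofReal_le_ofReal
    set r : Finset Ω → ℝ := fun A => ∑ z, p z * k z A with hr
    have hr0 : ∀ A, 0 ≤ r A := fun A => Finset.sum_nonneg fun z _ => mul_nonneg (hp.1 z) (hk0 z A)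
    have hr1 : ∑ A, r A = 1 := by
      simp only [hr]
      rw [Finset.sum_comm]
      simp_rw [← Finset.mul_sum, hk1, mul_one]
      exact hp.2
    have hg := gibbs Finset.univ r q (fun A _ => hr0 A) (fun A _ => hq.1 A) (by
      intro A _ h
      obtain ⟨z, -, hz⟩ := Finset.exists_ne_zero_of_sum_ne_zero h.ne'
      exact hkq z A (lt_of_le_of_ne (hk0 z A) (Ne.symm (right_ne_zero_of_mul hz))))
      (by rw [hr1, hq.2.2])
    have e1 : ∑ A, r A * Real.logb 2 (q A / r A)
        = ∑ z, ∑ A, p z * k z A * Real.logb 2 (q A / r A) := by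
      rw [Finset.sum_comm]
      apply Finset.sum_congr rfl
      intro A _
      rw [← Finset.sum_mul]
    have e2 : MI p k = ∑ z, ∑ A, p z * k z A * Real.logb 2 (q A / r A)
        + ∑ z, p z * Real.logb 2 (Qz q z)⁻¹ := by
      unfold MI
      rw [← Finset.sum_add_distrib]
      apply Finset.sum_congr rfl
      intro z _
      have : p z * Real.logb 2 (Qz q z)⁻¹ = ∑ A, p z * k z A * Real.logb 2 (Qz q z)⁻¹ := by
        rw [← Finset.sum_mul, ← Finset.mul_sum, hk1, mul_one]
      rw [this, ← Finset.sum_add_distrib]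
      apply Finset.sum_congr rfl
      intro A _
      rcases (hp.1 z).eq_or_lt with h | hz
      · simp [← h]
      rcases (hk0 z A).eq_or_lt with h | hkp
      · simp [← h]
      have hqA := hkq z A hkp
      have hQ := hfin z hz
      have hrA : 0 < r A := lt_of_lt_of_le (mul_pos hz hkp)
        (Finset.single_le_sum (f := fun z => p z * k z A)
          (fun z _ => mul_nonneg (hp.1 z) (hk0 z A)) (Finset.mem_univ z))
      have hzA : z ∈ A := hv.2.2.2 z A hz hkp
      have hkv : k z A = q A / Qz q z := by simp [hk, hQ, hzA]
      rw [← mul_add, ← Real.logb_mul (by positivity) (by positivity)]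
      congr 2
      change k z A / r A = _
      rw [hkv]
      field_simp
    rw [e2]; linarith
  · refine le_iInf₂ fun k hv => ?_
    obtain ⟨hk0, hk1, hkX, hkm⟩ := hv
    set r : Finset Ω → ℝ := fun A => ∑ z, p z * k z A with hr
    have hr0 : ∀ A, 0 ≤ r A := fun A => Finset.sum_nonneg fun z _ => mul_nonneg (hp.1 z) (hk0 z A)
    have hr1 : ∑ A, r A = 1 := by
      simp only [hr]
      rw [Finset.sum_comm]
      simp_rw [← Finset.mul_sum, hk1, mul_one]
      exact hp.2
    have hrp : ∀ z A, 0 < p z → 0 < k z A → 0 < r A := fun z A hz hkp =>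
      lt_of_lt_of_le (mul_pos hz hkp)
        (Finset.single_le_sum (f := fun z => p z * k z A)
          (fun z _ => mul_nonneg (hp.1 z) (hk0 z A)) (Finset.mem_univ z))
    have hq : IsQ X r := by
      refine ⟨hr0, ?_, hr1⟩
      intro A hA
      obtain ⟨z, -, hz⟩ := Finset.exists_ne_zero_of_sum_ne_zero hA
      exact hkX z A (lt_of_le_of_ne (hk0 z A) (Ne.symm (right_ne_zero_of_mul hz)))
    have hfin : ∀ z, 0 < p z → 0 < Qz r z := by
      intro z hz
      have : ∑ A, k z A ≠ 0 := by rw [hk1]; exact one_ne_zero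
      obtain ⟨A, -, hA⟩ := Finset.exists_ne_zero_of_sum_ne_zero this
      have hkp := lt_of_le_of_ne (hk0 z A) (Ne.symm hA)
      have h := Finset.single_le_sum (f := fun A => if z ∈ A then r A else 0)
        (fun A _ => by split_ifs <;> simp [hr0]) (Finset.mem_univ A)
      rw [if_pos (hkm z A hz hkp)] at h
      exact lt_of_lt_of_le (hrp z A hz hkp) h
    refine (G_le hq).trans ?_
    unfold Gcost
    rw [cost_eq hp.1 (Qz_nonneg hq.1) (Qz_le_one hq) hfin]
    apply ENNReal.ofReal_le_ofReal
    unfold MI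
    apply Finset.sum_le_sum
    intro z _
    rcases (hp.1 z).eq_or_lt with h | hz
    · simp [← h]
    simp_rw [mul_assoc, ← Finset.mul_sum]
    apply mul_le_mul_of_nonneg_left _ hz.le
    have hQ := hfin z hz
    have hg := gibbs Finset.univ (k z) (fun A => (if z ∈ A then r A else 0) / Qz r z)
      (fun A _ => hk0 z A)
      (fun A _ => div_nonneg (by split_ifs <;> simp [hr0]) hQ.le) (by
        intro A _ h
        simp only [hkm z A hz h, if_true]
        exact div_pos (hrp z A hz h) hQ)
      (by rw [← Finset.sum_div, hk1]; exact (div_self hQ.ne').le)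
    have e : ∑ A, k z A * Real.logb 2 (k z A / r A)
        + ∑ A, k z A * Real.logb 2 ((if z ∈ A then r A else 0) / Qz r z / k z A)
        = Real.logb 2 (Qz r z)⁻¹ := by
      have : Real.logb 2 (Qz r z)⁻¹ = ∑ A, k z A * Real.logb 2 (Qz r z)⁻¹ := by
        rw [← Finset.sum_mul, hk1, one_mul]
      rw [this, ← Finset.sum_add_distrib]
      apply Finset.sum_congr rfl
      intro A _
      rcases (hk0 z A).eq_or_lt with h | hkp
      · simp [← h]
      have hrA := hrp z A hz hkp
      rw [if_pos (hkm z A hz hkp), ← mul_add, ← Real.logb_mul (by positivity) (by positivity)]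
      congr 2
      field_simp
    change _ ≤ ∑ A, k z A * Real.logb 2 (k z A / r A)
    linarith

lemma G_mono_set (w : Ω → ℝ) {X Y : Finset (Finset Ω)} (h : X ⊆ Y) : Gent w Y ≤ Gent w X :=
  le_iInf₂ fun q hq => G_le ⟨hq.1, fun A hA => h (hq.2.1 A hA), hq.2.2⟩

lemma G_mono_w {w w' : Ω → ℝ} (h : ∀ z, w z ≤ w' z) (X : Finset (Finset Ω)) :
    Gent w X ≤ Gent w' X :=
  le_iInf₂ fun q hq => (G_le hq).trans <| Finset.sum_le_sum fun z _ =>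
    mul_le_mul_left (ENNReal.ofReal_le_ofReal (h z)) _

lemma Gcost_restr (p : Ω → ℝ) (E : Finset Ω) (g : Ω → ℝ≥0∞) :
    ∑ z, ENNReal.ofReal (restr p E z) * g z = ∑ z ∈ E, ENNReal.ofReal (p z) * g z := by
  rw [← Finset.sum_subset (Finset.subset_univ E)]
  · apply Finset.sum_congr rfl
    intro z hz
    simp [restr, hz]
  · intro z _ hz
    simp [restr, hz]

lemma hyp_empty {X : Finset (Finset Ω)} (hX : IsHyp X) : ∅ ∈ X := by
  obtain ⟨A, hA⟩ := hX.1
  exact hX.2 A hA ∅ (Finset.empty_subset A)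

lemma hyp_inter {X Y : Finset (Finset Ω)} (hX : IsHyp X) (hY : IsHyp Y) : IsHyp (X ∩ Y) := by
  refine ⟨⟨∅, Finset.mem_inter.2 ⟨hyp_empty hX, hyp_empty hY⟩⟩, ?_⟩
  intro A hA B hB
  rw [Finset.mem_inter] at hA ⊢
  exact ⟨hX.2 A hA.1 B hB, hY.2 A hA.2 B hB⟩

lemma hyp_powerset (E : Finset Ω) : IsHyp E.powerset := by
  refine ⟨⟨∅, by simp⟩, fun A hA B hB => ?_⟩
  rw [Finset.mem_powerset] at *
  exact hB.trans hA

lemma hyp_univ : IsHyp (Finset.univ : Finset (Finset Ω)) :=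
  ⟨⟨∅, by simp⟩, fun _ _ _ _ => Finset.mem_univ _⟩

lemma exists_isQ {X : Finset (Finset Ω)} (hX : IsHyp X) : ∃ q, IsQ X q := by
  refine ⟨fun A => if A = ∅ then 1 else 0, fun A => by dsimp only; split_ifs <;> norm_num, ?_, by simp⟩
  intro A hA
  have : A = ∅ := by by_contra h; simp [h] at hA
  rw [this]; exact hyp_empty hX

lemma G_zero {w : Ω → ℝ} (hw : ∀ z, w z ≤ 0) {X : Finset (Finset Ω)} (hX : IsHyp X) :
    Gent w X = 0 := by
  obtain ⟨q, hq⟩ := exists_isQ hX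
  refine le_antisymm ((G_le hq).trans ?_) bot_le
  unfold Gcost
  simp [ENNReal.ofReal_of_nonpos (hw _)]

lemma G_restr (p : Ω → ℝ) (E : Finset Ω) {X : Finset (Finset Ω)} (hX : IsHyp X) :
    Gent (restr p E) (X ∩ E.powerset) = Gent (restr p E) X := by
  apply le_antisymm
  · refine le_iInf₂ fun q hq => ?_
    refine (G_le_push (restr p E) _ q (fun A => A ∩ E) hq.1 hq.2.2 ?_).trans (le_of_eq ?_)
    · intro A hA
      rw [Finset.mem_inter, Finset.mem_powerset]
      exact ⟨hX.2 A (hq.2.1 A hA) _ Finset.inter_subset_left, Finset.inter_subset_right⟩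
    · unfold Gcost
      rw [Gcost_restr, Gcost_restr]
      apply Finset.sum_congr rfl
      intro z hz
      simp [Qz, hz]
  · exact G_mono_set _ Finset.inter_subset_left

lemma G_subadd (w : Ω → ℝ) {X Y : Finset (Finset Ω)} (hX : IsHyp X) (hY : IsHyp Y) :
    Gent w (X ∩ Y) ≤ Gent w X + Gent w Y := by
  have key : ∀ q, IsQ X q → ∀ q', IsQ Y q' → Gent w (X ∩ Y) ≤ Gcost w q + Gcost w q' := by
    intro q hq q' hq'
    refine (G_le_push w _ (fun x : Finset Ω × Finset Ω => q x.1 * q' x.2) (fun x => x.1 ∩ x.2)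
      (fun x => mul_nonneg (hq.1 _) (hq'.1 _)) ?_ ?_).trans (le_of_eq ?_)
    · rw [Fintype.sum_prod_type]
      simp_rw [← Finset.mul_sum]
      simp [hq.2.2, hq'.2.2]
    · intro x hx
      rw [Finset.mem_inter]
      exact ⟨hX.2 _ (hq.2.1 _ (left_ne_zero_of_mul hx)) _ Finset.inter_subset_left,
        hY.2 _ (hq'.2.1 _ (right_ne_zero_of_mul hx)) _ Finset.inter_subset_right⟩
    · unfold Gcost
      rw [← Finset.sum_add_distrib]
      apply Finset.sum_congr rfl
      intro z _
      rw [← mul_add, ← negLog2_mul (Qz_nonneg hq.1 z) (Qz_le_one hq z) (Qz_nonneg hq'.1 z)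
        (Qz_le_one hq' z)]
      congr 2
      unfold Qz
      rw [Finset.sum_mul_sum, Fintype.sum_prod_type]
      apply Finset.sum_congr rfl
      intro A _
      apply Finset.sum_congr rfl
      intro B _
      by_cases h1 : z ∈ A <;> by_cases h2 : z ∈ B <;> simp [h1, h2]
  have h2 : ∀ q, IsQ X q → Gent w (X ∩ Y) ≤ Gcost w q + Gent w Y := by
    intro q hq
    rw [← tsub_le_iff_left]
    exact le_iInf₂ fun q' hq' => tsub_le_iff_left.2 (key q hq q' hq')
  rw [← tsub_le_iff_right]
  exact le_iInf₂ fun q hq => tsub_le_iff_right.2 (h2 q hq)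

lemma G_scale (w : Ω → ℝ) {c : ℝ} (hc : 0 < c) (X : Finset (Finset Ω)) :
    Gent (fun z => c * w z) X = ENNReal.ofReal c * Gent w X := by
  unfold Gent
  have h0 : ENNReal.ofReal c ≠ 0 := by simpa using hc
  rw [ENNReal.mul_iInf_of_ne h0 ENNReal.ofReal_ne_top]
  congr 1; ext1 q
  rw [ENNReal.mul_iInf_of_ne h0 ENNReal.ofReal_ne_top]
  congr 1; ext1 hq
  unfold Gcost
  rw [Finset.mul_sum]
  apply Finset.sum_congr rfl
  intro z _
  rw [ENNReal.ofReal_mul hc.le, mul_assoc]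

lemma condEvent (p : Ω → ℝ) (hp : IsPMF p) {X : Finset (Finset Ω)} (hX : IsHyp X) (E : Finset Ω) :
    ENNReal.ofReal (pset p E) * HcondEvent p X E = Gent (restr p E) X := by
  have hnn : 0 ≤ pset p E := Finset.sum_nonneg fun z _ => hp.1 z
  rcases hnn.eq_or_lt with h | h
  · rw [← h]
    rw [G_zero _ hX]
    · simp
    · intro z
      unfold restr
      split_ifs with hz
      · rw [h]; exact Finset.single_le_sum (fun z _ => hp.1 z) hz
      · exact le_rfl
  · have hpm : IsPMF (condP p E) := by
      refine ⟨fun z => ?_, ?_⟩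
      · unfold condP; split_ifs
        · exact div_nonneg (hp.1 z) hnn
        · exact le_rfl
      · unfold condP
        rw [Finset.sum_ite_mem, Finset.univ_inter, ← Finset.sum_div]
        exact div_self h.ne'
    unfold HcondEvent
    rw [Hent_eq_G _ hpm, ← G_scale _ h, ← G_restr p E hX]
    congr 1
    ext z
    unfold condP restr
    split_ifs
    · field_simp
    · simp

lemma Hcond_eq (p : Ω → ℝ) (hp : IsPMF p) {X Y : Finset (Finset Ω)} (hX : IsHyp X)
    (hY : IsHyp Y) :
    Hcond p X Y = Gent (restr p (suppH Y)) (X ∩ Y) - Gent (restr p (suppH Y)) Y := by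
  rw [← condEvent p hp (hyp_inter hX hY), ← condEvent p hp hY]
  unfold Hcond
  split_ifs with h
  · simp [h]
  · rw [ENNReal.mul_sub]
    intro _ _; exact ENNReal.ofReal_ne_top

lemma gibbs_enn {ι : Type*} (M : Finset ι) (P r : ι → ℝ) (T : ℝ) (hP : ∀ i ∈ M, 0 ≤ P i)
    (hT : ∑ i ∈ M, P i = T) (hT0 : 0 < T) (hr : ∀ i ∈ M, 0 ≤ r i) (hr1 : ∑ i ∈ M, r i ≤ 1) :
    ∑ i ∈ M, ENNReal.ofReal (P i) * negLog2 (P i / T)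
      ≤ ∑ i ∈ M, ENNReal.ofReal (P i) * negLog2 (r i) := by
  by_cases hfin : ∀ i ∈ M, 0 < P i → 0 < r i
  swap
  · push Not at hfin
    obtain ⟨i, hi, hPi, hri⟩ := hfin
    have : ∑ i ∈ M, ENNReal.ofReal (P i) * negLog2 (r i) = ⊤ := by
      rw [ENNReal.sum_eq_top]
      refine ⟨i, hi, ?_⟩
      rw [negLog2_nonpos hri]
      exact ENNReal.mul_top (by simpa using hPi)
    rw [this]; exact le_top
  have hPT : ∀ i ∈ M, P i ≤ T := fun i hi => hT ▸ Finset.single_le_sum hP hi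
  have hrle : ∀ i ∈ M, r i ≤ 1 := fun i hi => (Finset.single_le_sum hr hi).trans hr1
  have key : ∀ Q : ι → ℝ, (∀ i ∈ M, 0 ≤ Q i) → (∀ i ∈ M, Q i ≤ 1) →
      (∀ i ∈ M, 0 < P i → 0 < Q i) →
      ∑ i ∈ M, ENNReal.ofReal (P i) * negLog2 (Q i)
      = ENNReal.ofReal (∑ i ∈ M, P i * Real.logb 2 (Q i)⁻¹) := by
    intro Q h0 h1 hpos
    rw [ENNReal.ofReal_sum_of_nonneg
      (fun z hz => mul_nonneg (hP z hz) (logb_inv_nonneg (h0 z hz) (h1 z hz)))]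
    apply Finset.sum_congr rfl
    intro z hz
    rcases (hP z hz).eq_or_lt with h | h
    · simp [← h]
    · rw [negLog2_pos (hpos z hz h), ENNReal.ofReal_mul h.le]
  rw [key r hr hrle hfin, key (fun i => P i / T) (fun i hi => div_nonneg (hP i hi) hT0.le)
    (fun i hi => (div_le_one hT0).2 (hPT i hi)) (fun i _ h => div_pos h hT0)]
  apply ENNReal.ofReal_le_ofReal
  have hg := gibbs M P (fun i => r i * T) hP (fun i hi => mul_nonneg (hr i hi) hT0.le)
    (fun i hi h => mul_pos (hfin i hi h) hT0) (by
      rw [← Finset.sum_mul, hT]; nlinarith)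
  have e : ∑ i ∈ M, P i * Real.logb 2 (P i / T)⁻¹ = ∑ i ∈ M, P i * Real.logb 2 (r i)⁻¹
      + ∑ i ∈ M, P i * Real.logb 2 (r i * T / P i) := by
    rw [← Finset.sum_add_distrib]
    apply Finset.sum_congr rfl
    intro i hi
    rcases (hP i hi).eq_or_lt with h | h
    · simp [← h]
    have := hfin i hi h
    rw [← mul_add, ← Real.logb_mul (by positivity) (by positivity)]
    congr 2
    field_simp
  linarith

lemma mem_maxsHyp {X : Finset (Finset Ω)} {A : Finset Ω} :
    A ∈ maxsHyp X ↔ A ∈ X ∧ ∀ B ∈ X, A ⊆ B → B = A := by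
  simp [maxsHyp]

lemma pset_nonneg {p : Ω → ℝ} (hp : IsPMF p) (E : Finset Ω) : 0 ≤ pset p E :=
  Finset.sum_nonneg fun z _ => hp.1 z

lemma decomp_ge (p : Ω → ℝ) (hp : IsPMF p) {X Y : Finset (Finset Ω)} (hX : IsHyp X)
    (M : Finset (Finset Ω)) (hM : ∀ A ∈ M, ∀ B ∈ M, A ≠ B → Disjoint A B)
    (hYM : ∀ C, C ∈ Y ↔ ∃ A ∈ M, C ⊆ A) (hT : 0 < pset p (M.biUnion id)) :
    ∑ E ∈ M, Gent (restr p E) X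
      + ∑ E ∈ M, ENNReal.ofReal (pset p E) * negLog2 (pset p E / pset p (M.biUnion id))
      ≤ Gent (restr p (M.biUnion id)) (X ∩ Y) := by
  have hMd : (M : Set (Finset Ω)).PairwiseDisjoint id := fun A hA B hB h => hM A hA B hB h
  refine le_iInf₂ fun q hq => ?_
  set r : Finset Ω → ℝ := fun E => ∑ A, if A.Nonempty ∧ A ⊆ E then q A else 0 with hr
  have hr0 : ∀ E, 0 ≤ r E := fun E => Finset.sum_nonneg fun A _ => by split_ifs <;> simp [hq.1]
  have hr1 : ∑ E ∈ M, r E ≤ 1 := by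
    simp only [hr]
    rw [Finset.sum_comm, ← hq.2.2]
    apply Finset.sum_le_sum
    intro A _
    by_cases h : ∃ E ∈ M, A.Nonempty ∧ A ⊆ E
    · obtain ⟨E, hE, hA, hAE⟩ := h
      rw [Finset.sum_eq_single_of_mem E hE]
      · simp [hA, hAE]
      · intro E' hE' hne
        rw [if_neg]
        rintro ⟨-, h'⟩
        obtain ⟨a, ha⟩ := hA
        exact Finset.disjoint_left.1 (hM E' hE' E hE hne) (h' ha) (hAE ha)
    · push Not at h
      rw [Finset.sum_eq_zero]
      · exact hq.1 A
      · intro E hE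
        rw [if_neg]
        rintro ⟨h1, h2⟩
        exact h E hE h1 h2
  have hQr : ∀ E ∈ M, ∀ z ∈ E,
      Qz q z = ∑ A, if z ∈ A then (if A.Nonempty ∧ A ⊆ E then q A else 0) else 0 := by
    intro E hE z hz
    apply Finset.sum_congr rfl
    intro A _
    split_ifs with h1 h2
    · rfl
    · by_contra hne
      apply h2
      have hA := hq.2.1 A hne
      rw [Finset.mem_inter, hYM] at hA
      obtain ⟨-, E', hE', hAE'⟩ := hA
      have : E' = E := by
        by_contra hn
        exact Finset.disjoint_left.1 (hM E' hE' E hE hn) (hAE' h1) hz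
      exact ⟨⟨z, h1⟩, this ▸ hAE'⟩
    · rfl
  have main : ∀ E ∈ M, Gent (restr p E) X + ENNReal.ofReal (pset p E) * negLog2 (r E)
      ≤ ∑ z ∈ E, ENNReal.ofReal (p z) * negLog2 (Qz q z) := by
    intro E hE
    rcases (hr0 E).eq_or_lt with h | h
    · rcases (pset_nonneg hp E).eq_or_lt with h' | h'
      · rw [G_zero _ hX]
        · simp [← h']
        · intro z
          unfold restr
          split_ifs with hz
          · rw [h']; exact Finset.single_le_sum (fun z _ => hp.1 z) hz
          · exact le_rfl
      · obtain ⟨z, hz, hpz⟩ := Finset.exists_ne_zero_of_sum_ne_zero h'.ne'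
        have : ∑ z ∈ E, ENNReal.ofReal (p z) * negLog2 (Qz q z) = ⊤ := by
          rw [ENNReal.sum_eq_top]
          refine ⟨z, hz, ?_⟩
          rw [negLog2_nonpos]
          · exact ENNReal.mul_top (by simpa using lt_of_le_of_ne (hp.1 z) (Ne.symm hpz))
          · refine le_trans ?_ h.ge
            rw [hQr E hE z hz]
            apply Finset.sum_le_sum
            intro A _
            by_cases hzA : z ∈ A
            · rw [if_pos hzA]
            · rw [if_neg hzA]; split_ifs <;> simp [hq.1]
        rw [this]; exact le_top
    · have hpush := G_le_push (restr p E) X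
        (fun A => (if A.Nonempty ∧ A ⊆ E then q A else 0) / r E) (fun A => A)
        (fun A => div_nonneg (by split_ifs <;> simp [hq.1]) h.le)
        (by rw [← Finset.sum_div]; exact div_self h.ne')
        (by
          intro A hA
          have hA' : q A ≠ 0 := by
            intro h0; simp [h0] at hA
          exact (Finset.mem_inter.1 (hq.2.1 A hA')).1)
      rw [Gcost_restr] at hpush
      have e1 : ENNReal.ofReal (pset p E) * negLog2 (r E)
          = ∑ z ∈ E, ENNReal.ofReal (p z) * negLog2 (r E) := by
        unfold pset
        rw [ENNReal.ofReal_sum_of_nonneg fun z _ => hp.1 z, Finset.sum_mul]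
      rw [e1]
      refine (add_le_add_left hpush _).trans (le_of_eq ?_)
      rw [← Finset.sum_add_distrib]
      apply Finset.sum_congr rfl
      intro z hz
      have e2 : (∑ A, if z ∈ A then (if A.Nonempty ∧ A ⊆ E then q A else 0) / r E else 0)
          = Qz q z / r E := by
        rw [hQr E hE z hz, Finset.sum_div]
        apply Finset.sum_congr rfl
        intro A _
        split_ifs <;> simp
      have hle : Qz q z ≤ r E := by
        rw [hQr E hE z hz]
        apply Finset.sum_le_sum
        intro A _
        by_cases hzA : z ∈ A
        · rw [if_pos hzA]
        · rw [if_neg hzA]; split_ifs <;> simp [hq.1]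
      rw [e2, ← mul_add, ← negLog2_mul (div_nonneg (Qz_nonneg hq.1 z) h.le)
        ((div_le_one h).2 hle) h.le ((Finset.single_le_sum (fun E _ => hr0 E) hE).trans hr1)]
      rw [div_mul_cancel₀ _ h.ne']
  have hTs : ∑ E ∈ M, pset p E = pset p (M.biUnion id) := by
    unfold pset
    rw [Finset.sum_biUnion hMd]
    rfl
  have hg := gibbs_enn M (pset p) r _ (fun E _ => pset_nonneg hp E) hTs hT (fun E _ => hr0 E) hr1
  calc _ ≤ ∑ E ∈ M, Gent (restr p E) X
      + ∑ E ∈ M, ENNReal.ofReal (pset p E) * negLog2 (r E) := by gcongr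
    _ = ∑ E ∈ M, (Gent (restr p E) X + ENNReal.ofReal (pset p E) * negLog2 (r E)) := by
        rw [Finset.sum_add_distrib]
    _ ≤ ∑ E ∈ M, ∑ z ∈ E, ENNReal.ofReal (p z) * negLog2 (Qz q z) := Finset.sum_le_sum main
    _ = Gcost (restr p (M.biUnion id)) q := by
        unfold Gcost
        rw [Gcost_restr, Finset.sum_biUnion hMd]
        rfl

lemma decomp_le (p : Ω → ℝ) (hp : IsPMF p) {X Y : Finset (Finset Ω)} (hX : IsHyp X)
    (M : Finset (Finset Ω)) (hM : ∀ A ∈ M, ∀ B ∈ M, A ≠ B → Disjoint A B)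
    (hYM : ∀ C, C ∈ Y ↔ ∃ A ∈ M, C ⊆ A) (hT : 0 < pset p (M.biUnion id)) :
    Gent (restr p (M.biUnion id)) (X ∩ Y) ≤ ∑ E ∈ M, Gent (restr p E) X
      + ∑ E ∈ M, ENNReal.ofReal (pset p E) * negLog2 (pset p E / pset p (M.biUnion id)) := by
  have hMd : (M : Set (Finset Ω)).PairwiseDisjoint id := fun A hA B hB h => hM A hA B hB h
  set T := pset p (M.biUnion id) with hTdef
  have hTs : ∑ E ∈ M, pset p E = T := by
    rw [hTdef]
    unfold pset
    rw [Finset.sum_biUnion hMd]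
    rfl
  have key : ∀ q : Finset Ω → Finset Ω → ℝ, (∀ E, IsQ X (q E)) →
      Gent (restr p (M.biUnion id)) (X ∩ Y) ≤ ∑ E ∈ M, Gcost (restr p E) (q E)
      + ∑ E ∈ M, ENNReal.ofReal (pset p E) * negLog2 (pset p E / T) := by
    intro q hq
    have hc0 : ∀ x : Finset Ω × Finset Ω, 0 ≤ (if x.1 ∈ M then pset p x.1 / T * q x.1 x.2 else 0) := by
      intro x
      split_ifs
      · exact mul_nonneg (div_nonneg (pset_nonneg hp _) hT.le) ((hq _).1 _)
      · exact le_rfl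
    refine (G_le_push _ _ (fun x : Finset Ω × Finset Ω =>
      if x.1 ∈ M then pset p x.1 / T * q x.1 x.2 else 0) (fun x => x.2 ∩ x.1) hc0 ?_ ?_).trans ?_
    · rw [Fintype.sum_prod_type]
      have : ∀ E : Finset Ω, (∑ A, if E ∈ M then pset p E / T * q E A else 0)
          = if E ∈ M then pset p E / T else 0 := by
        intro E
        split_ifs
        · rw [← Finset.mul_sum, (hq E).2.2, mul_one]
        · simp
      simp only [this]
      rw [Finset.sum_ite_mem, Finset.univ_inter, ← Finset.sum_div, hTs]
      exact div_self hT.ne'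
    · rintro ⟨E, A⟩ h
      have hE : E ∈ M := by by_contra hE; simp [hE] at h
      simp only [hE, if_true] at h
      rw [Finset.mem_inter]
      exact ⟨hX.2 _ ((hq E).2.1 A (right_ne_zero_of_mul h)) _ Finset.inter_subset_left,
        (hYM _).2 ⟨E, hE, Finset.inter_subset_right⟩⟩
    · rw [Gcost_restr, Finset.sum_biUnion hMd, ← Finset.sum_add_distrib]
      apply Finset.sum_le_sum
      intro E hE
      unfold Gcost
      rw [Gcost_restr]
      have e1 : ENNReal.ofReal (pset p E) * negLog2 (pset p E / T)
          = ∑ z ∈ E, ENNReal.ofReal (p z) * negLog2 (pset p E / T) := by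
        conv_lhs => enter [1]; unfold pset
        rw [ENNReal.ofReal_sum_of_nonneg fun z _ => hp.1 z, Finset.sum_mul]
      rw [e1, ← Finset.sum_add_distrib]
      apply Finset.sum_le_sum
      intro z hz
      change z ∈ E at hz
      have hPT : pset p E ≤ T := hTs ▸ Finset.single_le_sum (fun E _ => pset_nonneg hp E) hE
      rw [← mul_add, ← negLog2_mul (Qz_nonneg (hq E).1 z) (Qz_le_one (hq E) z)
        (div_nonneg (pset_nonneg hp E) hT.le) ((div_le_one hT).2 hPT)]
      gcongr
      apply negLog2_anti
      rw [Fintype.sum_prod_type]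
      have hs := Finset.single_le_sum (s := Finset.univ) (a := E)
        (f := fun E : Finset Ω => ∑ A : Finset Ω,
          if z ∈ A ∩ E then (if E ∈ M then pset p E / T * q E A else 0) else 0)
        (fun E _ => Finset.sum_nonneg fun A _ => by
          split_ifs with h1 h2
          · have := hc0 (E, A); simpa [h2] using this
          · exact le_rfl
          · exact le_rfl) (Finset.mem_univ E)
      refine le_trans (le_of_eq ?_) hs
      unfold Qz
      rw [mul_comm, Finset.mul_sum]
      apply Finset.sum_congr rfl
      intro A _
      by_cases hA : z ∈ A <;> simp [hA, hz, hE]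
  by_cases htop : ∑ E ∈ M, Gent (restr p E) X = ⊤
  · rw [htop, top_add]; exact le_top
  have hfin : ∀ E ∈ M, Gent (restr p E) X ≠ ⊤ := by
    intro E hE h
    exact htop (ENNReal.sum_eq_top.2 ⟨E, hE, h⟩)
  obtain ⟨q₀, hq₀⟩ := exists_isQ hX
  refine ENNReal.le_of_forall_pos_le_add fun ε hε _ => ?_
  have hMne : M.Nonempty := by
    rw [Finset.nonempty_iff_ne_empty]
    rintro rfl
    simp [hTdef, pset] at hT
  have hcard : (M.card : ℝ≥0∞) ≠ 0 := by simpa using hMne.ne_empty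
  have hδ : (ε : ℝ≥0∞) / M.card ≠ 0 :=
    ENNReal.div_ne_zero.2 ⟨by simpa using hε.ne', ENNReal.natCast_ne_top _⟩
  have hex : ∀ E : Finset Ω, ∃ q, IsQ X q ∧
      (E ∈ M → Gcost (restr p E) q ≤ Gent (restr p E) X + (ε : ℝ≥0∞) / M.card) := by
    intro E
    by_cases hE : E ∈ M
    · have hlt : Gent (restr p E) X < Gent (restr p E) X + (ε : ℝ≥0∞) / M.card :=
        ENNReal.lt_add_right (hfin E hE) hδ
      conv_lhs at hlt => unfold Gent
      obtain ⟨q, hq⟩ := iInf_lt_iff.1 hlt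
      obtain ⟨hq1, hq2⟩ := iInf_lt_iff.1 hq
      exact ⟨q, hq1, fun _ => hq2.le⟩
    · exact ⟨q₀, hq₀, fun h => absurd h hE⟩
  choose q hq1 hq2 using hex
  refine (key q hq1).trans ?_
  calc _ ≤ ∑ E ∈ M, (Gent (restr p E) X + (ε : ℝ≥0∞) / M.card)
        + ∑ E ∈ M, ENNReal.ofReal (pset p E) * negLog2 (pset p E / T) :=
        add_le_add_left (Finset.sum_le_sum fun E hE => hq2 E hE) _
    _ = _ := by
      rw [Finset.sum_add_distrib, Finset.sum_const, nsmul_eq_mul,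
        ENNReal.mul_div_cancel hcard (ENNReal.natCast_ne_top _)]
      ring

lemma G_univ (w : Ω → ℝ) : Gent w (Finset.univ : Finset (Finset Ω)) = 0 := by
  refine le_antisymm ?_ bot_le
  refine (G_le_push w _ (fun _ : Unit => (1 : ℝ)) (fun _ => Finset.univ) (by simp) (by simp)
    (by simp)).trans ?_
  simp [negLog2_one]

lemma Hcond_OI (p : Ω → ℝ) (hp : IsPMF p) {X Y : Finset (Finset Ω)} (hX : IsHyp X)
    (hY : IsHyp Y) (hOI : IsOI Y) :
    Hcond p X Y = ∑ E ∈ maxsHyp Y, ENNReal.ofReal (pset p E) * HcondEvent p X E := by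
  obtain ⟨S, -, hS, hSY⟩ := hOI
  have hMS : maxsHyp Y ⊆ S := by
    intro E hE
    obtain ⟨hE1, hE2⟩ := mem_maxsHyp.1 hE
    obtain ⟨A, hA, hEA⟩ := (hSY E).1 hE1
    rw [← hE2 A ((hSY A).2 ⟨A, hA, subset_rfl⟩) hEA]
    exact hA
  have hM : ∀ A ∈ maxsHyp Y, ∀ B ∈ maxsHyp Y, A ≠ B → Disjoint A B :=
    fun A hA B hB => hS A (hMS hA) B (hMS hB)
  have hYM : ∀ C, C ∈ Y ↔ ∃ A ∈ maxsHyp Y, C ⊆ A := by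
    intro C
    constructor
    · intro hC
      obtain ⟨A, hCA, hA⟩ := Finset.exists_le_maximal Y hC
      refine ⟨A, mem_maxsHyp.2 ⟨hA.1, fun B hB hAB => ?_⟩, hCA⟩
      exact (hA.2 hB hAB).antisymm hAB
    · rintro ⟨A, hA, hCA⟩
      exact hY.2 A (mem_maxsHyp.1 hA).1 C hCA
  have hsupp : suppH Y = (maxsHyp Y).biUnion id := by
    ext z
    simp [suppH, hYM]
  rw [Hcond_eq p hp hX hY]
  simp_rw [condEvent p hp hX]
  rw [hsupp]
  have hd : ∀ X', IsHyp X' → 0 < pset p ((maxsHyp Y).biUnion id) →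
      Gent (restr p ((maxsHyp Y).biUnion id)) (X' ∩ Y) = _ := fun X' hX' hT =>
    le_antisymm (decomp_le p hp hX' _ hM hYM hT) (decomp_ge p hp hX' _ hM hYM hT)
  rcases (pset_nonneg hp ((maxsHyp Y).biUnion id)).eq_or_lt with h | hT
  · have hz : ∀ z ∈ (maxsHyp Y).biUnion id, p z ≤ 0 := by
      intro z hz
      rw [h]; exact Finset.single_le_sum (fun z _ => hp.1 z) hz
    rw [G_zero _ (hyp_inter hX hY), zero_tsub, Finset.sum_eq_zero]
    · intro E hE
      apply G_zero _ hX
      intro z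
      unfold restr
      split_ifs with hzE
      · exact hz z (Finset.mem_biUnion.2 ⟨E, hE, hzE⟩)
      · exact le_rfl
    · intro z
      unfold restr
      split_ifs with hzE
      · exact hz z hzE
      · exact le_rfl
  · have h1 := hd X hX hT
    have h2 := hd Finset.univ hyp_univ hT
    simp only [Finset.univ_inter, G_univ, Finset.sum_const_zero, zero_add] at h2
    rw [h1, h2]
    apply ENNReal.add_sub_cancel_right
    rw [Ne, ENNReal.sum_eq_top]
    rintro ⟨E, hE, hEt⟩
    rcases (pset_nonneg hp E).eq_or_lt with h | h
    · simp [← h] at hEt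
    · rw [negLog2_pos (div_pos h hT)] at hEt
      exact ENNReal.mul_ne_top ENNReal.ofReal_ne_top ENNReal.ofReal_ne_top hEt

lemma restr_univ (p : Ω → ℝ) : restr p Finset.univ = p := by
  ext z; simp [restr]

lemma restr_le {p : Ω → ℝ} (hp : IsPMF p) (E : Finset Ω) (z : Ω) : restr p E z ≤ p z := by
  unfold restr; split_ifs
  · exact le_rfl
  · exact hp.1 z

lemma G_top (p : Ω → ℝ) {X Y : Finset (Finset Ω)} (hXY : X ⊆ Y) (hY : IsHyp Y) {z : Ω}
    (hz : 0 < p z) (hzY : z ∉ suppH Y) : Gent p X = ⊤ := by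
  rw [eq_top_iff]
  refine le_iInf₂ fun q hq => ?_
  rw [top_le_iff]
  unfold Gcost
  rw [ENNReal.sum_eq_top]
  refine ⟨z, Finset.mem_univ z, ?_⟩
  have : Qz q z = 0 := by
    apply Finset.sum_eq_zero
    intro A _
    split_ifs with hzA
    · by_contra hA
      apply hzY
      simp only [suppH, Finset.mem_filter, Finset.mem_univ, true_and]
      exact hY.2 A (hXY (hq.2.1 A hA)) _ (by simpa using hzA)
    · rfl
  rw [this, negLog2_nonpos le_rfl]
  exact ENNReal.mul_top (by simpa using hz)

end helpers

/-- Properties of the conditional entropy `H(X|Y)`: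
(i) `0 ≤ H(X|Y) ≤ H(X)`; (ii) `H(X|2^Ω) = H(X)` and `H(X|{∅}) = 0`;
(iii) `H(X|Y) + H(Y) = H(X ∩ Y)`; (iv) if `Y` is an ordinary information then
`H(X|Y) = Σ_{E ∈ maxs(Y)} p(E) H(X|E)`, and in particular
`H(X|2^E) = p(E) H(X|E)` for every `E ⊆ Ω`. -/
theorem stmt12 [Fintype Ω] (p : Ω → ℝ) (hp : IsPMF p)
    (X Y : Finset (Finset Ω)) (hX : IsHyp X) (hY : IsHyp Y) :
    (0 ≤ Hcond p X Y ∧ Hcond p X Y ≤ Hent p X) ∧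
    Hcond p X (Finset.univ : Finset (Finset Ω)) = Hent p X ∧
    Hcond p X ({(∅ : Finset Ω)} : Finset (Finset Ω)) = 0 ∧
    Hcond p X Y + Hent p Y = Hent p (X ∩ Y) ∧
    (IsOI Y →
      Hcond p X Y = ∑ E ∈ maxsHyp Y, ENNReal.ofReal (pset p E) * HcondEvent p X E) ∧
    (∀ E : Finset Ω,
      Hcond p X E.powerset = ENNReal.ofReal (pset p E) * HcondEvent p X E) := by
  refine ⟨⟨bot_le, ?_⟩, ?_, ?_, ?_, Hcond_OI p hp hX hY, ?_⟩
  · rw [Hcond_eq p hp hX hY, Hent_eq_G p hp, tsub_le_iff_right]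
    refine (G_subadd _ hX hY).trans ?_
    gcongr
    exact G_mono_w (restr_le hp _) X
  · rw [Hcond_eq p hp hX hyp_univ, Hent_eq_G p hp, G_univ, tsub_zero, Finset.inter_univ]
    have : suppH (Finset.univ : Finset (Finset Ω)) = Finset.univ := by
      ext z; simp [suppH]
    rw [this, restr_univ]
  · have : suppH ({(∅ : Finset Ω)} : Finset (Finset Ω)) = ∅ := by
      ext z; simp [suppH]
    simp [Hcond, this, pset]
  · rw [Hent_eq_G p hp, Hent_eq_G p hp]
    by_cases h : ∃ z, 0 < p z ∧ z ∉ suppH Y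
    · obtain ⟨z, hz, hzY⟩ := h
      rw [G_top p subset_rfl hY hz hzY, G_top p Finset.inter_subset_right hY hz hzY, add_top]
    · push Not at h
      have hr : restr p (suppH Y) = p := by
        ext z
        unfold restr
        split_ifs with hz
        · rfl
        · by_contra hne
          exact hz (h z (lt_of_le_of_ne (hp.1 z) hne))
      rw [Hcond_eq p hp hX hY, hr]
      exact tsub_add_cancel_of_le (G_mono_set p Finset.inter_subset_right)
  · intro E
    have hm : maxsHyp E.powerset = {E} := by
      ext A
      simp only [mem_maxsHyp, Finset.mem_powerset, Finset.mem_singleton]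
      constructor
      · rintro ⟨h1, h2⟩
        exact (h2 E subset_rfl h1).symm
      · rintro rfl
        exact ⟨subset_rfl, fun B hB hAB => hB.antisymm hAB⟩
    rw [Hcond_OI p hp hX (hyp_powerset E) ⟨{E}, by simp, by simp, by simp⟩, hm,
      Finset.sum_singleton]

end
end

section
/- Let X, Y be hyperconfusions over a finite probability space (Ω, p). Then H(X→Y) ≥ H(Y|X), where X→Y := {A ⊆ Ω : X ∩ 2^A ⊆ Y} is the Heyting implication. Moreover, if X ∈ OIs(Ω) is an ordinary information, then H(X→Y) = H(Y|X). -/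
open Finset
open scoped Classical ENNReal

noncomputable section

variable {Ω : Type*}

lemma gibbs_aux {ι : Type*} [Fintype ι] (a b : ι → ℝ) (ha : ∀ i, 0 ≤ a i) (hb : ∀ i, 0 ≤ b i)
    (hab : ∀ i, 0 < a i → 0 < b i) (hs : ∑ i, b i ≤ ∑ i, a i) :
    0 ≤ ∑ i, a i * Real.logb 2 (a i / b i) := by
  have hl2 : 0 < Real.log 2 := Real.log_pos (by norm_num)
  have key : ∀ i, (a i - b i) / Real.log 2 ≤ a i * Real.logb 2 (a i / b i) := by
    intro i
    rcases (ha i).eq_or_lt with h | h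
    · rw [← h]; simp only [zero_mul, zero_sub]
      exact div_nonpos_of_nonpos_of_nonneg (by linarith [hb i]) hl2.le
    · have hbi := hab i h
      have h1 := Real.log_le_sub_one_of_pos (div_pos hbi h)
      have h2 : Real.log (a i / b i) = - Real.log (b i / a i) := by
        rw [← Real.log_inv, inv_div]
      have h3 : a i * (b i / a i - 1) = b i - a i := by field_simp
      rw [Real.logb, h2, mul_div_assoc']
      apply div_le_div_of_nonneg_right _ hl2.le
      nlinarith [mul_le_mul_of_nonneg_left h1 h.le]
  calc 0 ≤ (∑ i, a i - ∑ i, b i) / Real.log 2 := div_nonneg (by linarith) hl2.le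
    _ = ∑ i, (a i - b i) / Real.log 2 := by rw [← Finset.sum_sub_distrib, Finset.sum_div]
    _ ≤ _ := Finset.sum_le_sum fun i _ => key i

/-- Data processing together with the variational bound on the mutual information. -/
lemma MI_push_le [Fintype Ω] {ι : Type*} [Fintype ι] (p : Ω → ℝ) (hp : IsPMF p)
    (K : Ω → ι → ℝ) (f : ι → Finset Ω) (hK0 : ∀ z i, 0 ≤ K z i) (hK1 : ∀ z, ∑ i, K z i = 1)
    (Q : ι → ℝ) (hQ0 : ∀ i, 0 ≤ Q i) (hQ1 : ∑ i, Q i ≤ 1)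
    (hQ : ∀ z i, 0 < p z → 0 < K z i → 0 < Q i) :
    MI p (fun z A => ∑ i, if f i = A then K z i else 0) ≤
      ∑ z, ∑ i, p z * K z i * Real.logb 2 (K z i / Q i) := by
  set k : Ω → Finset Ω → ℝ := fun z A => ∑ i, if f i = A then K z i else 0 with hk
  set q : Finset Ω → ℝ := fun A => ∑ z, p z * k z A with hq
  have hk0 : ∀ z A, 0 ≤ k z A := fun z A =>
    Finset.sum_nonneg fun i _ => by split_ifs; exacts [hK0 z i, le_rfl]
  have hq0 : ∀ A, 0 ≤ q A := fun A =>
    Finset.sum_nonneg fun z _ => mul_nonneg (hp.1 z) (hk0 z A)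
  have hkK : ∀ z i, K z i ≤ k z (f i) := by
    intro z i
    have := Finset.single_le_sum (f := fun j => if f j = f i then K z j else 0)
      (fun j _ => by split_ifs; exacts [hK0 z j, le_rfl]) (Finset.mem_univ i)
    simpa using this
  have hqk : ∀ z A, p z * k z A ≤ q A := fun z A =>
    Finset.single_le_sum (f := fun z => p z * k z A)
      (fun z _ => mul_nonneg (hp.1 z) (hk0 z A)) (Finset.mem_univ z)
  have hMI : MI p k = ∑ z, ∑ i, p z * K z i * Real.logb 2 (k z (f i) / q (f i)) := by
    unfold MI
    refine Finset.sum_congr rfl fun z _ => ?_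
    have : ∀ A, p z * k z A * Real.logb 2 (k z A / ∑ z', p z' * k z' A) =
        ∑ i, if f i = A then p z * K z i * Real.logb 2 (k z (f i) / q (f i)) else 0 := by
      intro A
      change p z * k z A * Real.logb 2 (k z A / q A) = _
      have e : p z * k z A * Real.logb 2 (k z A / q A)
          = ∑ i, (p z * Real.logb 2 (k z A / q A)) * (if f i = A then K z i else 0) := by
        rw [← Finset.mul_sum]; simp only [hk]; ring
      rw [e]
      refine Finset.sum_congr rfl fun i _ => ?_
      split_ifs with h
      · rw [h]; ring
      · simp
    rw [Finset.sum_congr rfl fun A _ => this A, Finset.sum_comm]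
    simp
  rw [hMI, ← sub_nonneg]
  let a : Ω × ι → ℝ := fun x => p x.1 * K x.1 x.2
  let b : Ω × ι → ℝ := fun x => Q x.2 * (p x.1 * k x.1 (f x.2) / q (f x.2))
  have g := gibbs_aux a b (fun x => mul_nonneg (hp.1 _) (hK0 _ _))
    (fun x => mul_nonneg (hQ0 _) (div_nonneg (mul_nonneg (hp.1 _) (hk0 _ _)) (hq0 _)))
    (by
      rintro ⟨z, i⟩ h
      have hpz : 0 < p z := lt_of_le_of_ne (hp.1 z) (by rintro hx; simp [a, ← hx] at h)
      have hKz : 0 < K z i := lt_of_le_of_ne (hK0 z i) (by rintro hx; simp [a, ← hx] at h)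
      have h1 := hQ z i hpz hKz
      have h2 := hKz.trans_le (hkK z i)
      have h3 := (mul_pos hpz h2).trans_le (hqk z (f i))
      exact mul_pos h1 (div_pos (mul_pos hpz h2) h3))
    (by
      have ha : ∑ x, a x = 1 := by
        rw [Fintype.sum_prod_type]
        simp only [a, ← Finset.mul_sum, hK1, mul_one, hp.2]
      have hb : ∑ x, b x ≤ ∑ i, Q i := by
        rw [Fintype.sum_prod_type_right]
        refine Finset.sum_le_sum fun i _ => ?_
        simp only [b, ← Finset.mul_sum, ← Finset.sum_div]
        exact mul_le_of_le_one_right (hQ0 i) (div_self_le_one (q (f i)))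
      linarith)
  refine g.trans_eq ?_
  rw [Fintype.sum_prod_type, ← Finset.sum_sub_distrib]
  refine Finset.sum_congr rfl fun z _ => ?_
  rw [← Finset.sum_sub_distrib]
  refine Finset.sum_congr rfl fun i _ => ?_
  simp only [a, b]
  rcases (hp.1 z).eq_or_lt with h | hpz
  · simp [← h]
  rcases (hK0 z i).eq_or_lt with h | hKz
  · simp [← h]
  have h1 := hQ z i hpz hKz
  have h2 := hKz.trans_le (hkK z i)
  have h3 := (mul_pos hpz h2).trans_le (hqk z (f i))
  rw [← mul_sub, ← Real.logb_div (by positivity) (by positivity)]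
  congr 2
  field_simp

lemma Hent_le_push [Fintype Ω] {ι : Type*} [Fintype ι] (p : Ω → ℝ) (hp : IsPMF p)
    (X : Finset (Finset Ω))
    (K : Ω → ι → ℝ) (f : ι → Finset Ω) (hK0 : ∀ z i, 0 ≤ K z i) (hK1 : ∀ z, ∑ i, K z i = 1)
    (hKX : ∀ z i, 0 < K z i → f i ∈ X) (hKz : ∀ z i, 0 < p z → 0 < K z i → z ∈ f i)
    (Q : ι → ℝ) (hQ0 : ∀ i, 0 ≤ Q i) (hQ1 : ∑ i, Q i ≤ 1)
    (hQ : ∀ z i, 0 < p z → 0 < K z i → 0 < Q i) :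
    Hent p X ≤ ENNReal.ofReal (∑ z, ∑ i, p z * K z i * Real.logb 2 (K z i / Q i)) := by
  have hex : ∀ z A, 0 < (∑ i, if f i = A then K z i else 0) → ∃ i, f i = A ∧ 0 < K z i := by
    intro z A h
    by_contra! hc
    have : (∑ i, if f i = A then K z i else 0) ≤ 0 :=
      Finset.sum_nonpos fun i _ => by
        split_ifs with hx
        exacts [hc i hx, le_rfl]
    linarith
  refine (iInf₂_le (fun z A => ∑ i, if f i = A then K z i else 0) ⟨?_, ?_, ?_, ?_⟩).trans
    (ENNReal.ofReal_le_ofReal (MI_push_le p hp K f hK0 hK1 Q hQ0 hQ1 hQ))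
  · exact fun z A => Finset.sum_nonneg fun i _ => by split_ifs; exacts [hK0 z i, le_rfl]
  · intro z
    rw [Finset.sum_comm]
    simp [hK1]
  · intro z A h
    obtain ⟨i, rfl, hi⟩ := hex z A h
    exact hKX z i hi
  · intro z A hz h
    obtain ⟨i, rfl, hi⟩ := hex z A h
    exact hKz z i hz hi

lemma condP_isPMF [Fintype Ω] (p : Ω → ℝ) (hp : IsPMF p) (E : Finset Ω) (hE : pset p E ≠ 0) :
    IsPMF (condP p E) := by
  have h0 : 0 ≤ pset p E := Finset.sum_nonneg fun z _ => hp.1 z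
  refine ⟨fun z => ?_, ?_⟩
  · unfold condP; split_ifs
    exacts [div_nonneg (hp.1 z) h0, le_rfl]
  · simp only [condP, Finset.sum_ite_mem, Finset.univ_inter, ← Finset.sum_div]
    exact div_self hE

lemma part_one [Fintype Ω] (p : Ω → ℝ) (hp : IsPMF p)
    (X Y : Finset (Finset Ω)) (hX : IsHyp X) (hY : IsHyp Y) :
    Hcond p Y X ≤ Hent p (himpHyp X Y) := by
  unfold Hcond
  split_ifs with hE
  · exact zero_le
  set E := suppH X with hEdef
  have hc : 0 < pset p E :=
    lt_of_le_of_ne (Finset.sum_nonneg fun z _ => hp.1 z) (Ne.symm hE)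
  set c := pset p E with hcdef
  set r := condP p E with hr
  have hrP : IsPMF r := condP_isPMF p hp E hE
  have hrE : ∀ z, 0 < r z → z ∈ E ∧ 0 < p z := by
    intro z h
    simp only [hr, condP] at h
    split_ifs at h with hz
    · exact ⟨hz, by have := (div_pos_iff_of_pos_right hc).1 h; exact this⟩
    · exact absurd h (lt_irrefl _)
  have hcr : ∀ z ∈ E, c * r z = p z := by
    intro z hz
    simp only [hr, condP, if_pos hz]
    exact mul_div_cancel₀ _ hE
  refine le_iInf₂ fun k hk => ?_
  obtain ⟨hk0, hk1, hkX, hkz⟩ := hk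
  set q : Finset Ω → ℝ := fun A => ∑ z, p z * k z A with hq
  have hq0 : ∀ A, 0 ≤ q A := fun A => Finset.sum_nonneg fun z _ => mul_nonneg (hp.1 z) (hk0 z A)
  have hq1 : ∑ A, q A = 1 := by
    simp only [hq]; rw [Finset.sum_comm]; simp only [← Finset.mul_sum, hk1, mul_one, hp.2]
  have hqpos : ∀ z A, 0 < p z → 0 < k z A → 0 < q A := fun z A h1 h2 =>
    (mul_pos h1 h2).trans_le (Finset.single_le_sum (f := fun z => p z * k z A)
      (fun z _ => mul_nonneg (hp.1 z) (hk0 z A)) (Finset.mem_univ z))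
  set D : Ω → ℝ := fun z => ∑ A, k z A * Real.logb 2 (k z A / q A) with hD
  have hD0 : ∀ z, 0 < p z → 0 ≤ D z := fun z hz =>
    gibbs_aux (k z) q (hk0 z) hq0 (fun A h => hqpos z A hz h) (by rw [hq1, hk1])
  set M := ∑ z, r z * D z with hM
  have hM0 : 0 ≤ M := Finset.sum_nonneg fun z _ => by
    rcases (hrP.1 z).eq_or_lt with h | h
    · simp [← h]
    · exact mul_nonneg h.le (hD0 z (hrE z h).2)
  have hMI : c * M ≤ MI p k := by
    have : MI p k = ∑ z, p z * D z := by
      unfold MI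
      refine Finset.sum_congr rfl fun z _ => ?_
      simp only [hD, Finset.mul_sum]
      exact Finset.sum_congr rfl fun A _ => by rw [mul_assoc]
    rw [this, hM, Finset.mul_sum]
    refine Finset.sum_le_sum fun z _ => ?_
    by_cases hz : z ∈ E
    · rw [← mul_assoc, hcr z hz]
    · have : r z = 0 := by simp [hr, condP, hz]
      rw [this]
      rcases (hp.1 z).eq_or_lt with h | h
      · simp [← h]
      · simpa using mul_nonneg h.le (hD0 z h)
  have main : HcondEvent p (Y ∩ X) E ≤ ENNReal.ofReal M + HcondEvent p X E := by
    unfold HcondEvent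
    rw [← hr]
    conv_rhs => unfold Hent
    simp only [ENNReal.add_iInf]
    refine le_iInf₂ fun kk hkk => ?_
    obtain ⟨hkk0, hkk1, hkkX, hkkz⟩ := hkk
    set qq : Finset Ω → ℝ := fun A => ∑ z, r z * kk z A with hqq
    have hqq0 : ∀ A, 0 ≤ qq A :=
      fun A => Finset.sum_nonneg fun z _ => mul_nonneg (hrP.1 z) (hkk0 z A)
    have hqq1 : ∑ A, qq A = 1 := by
      simp only [hqq]; rw [Finset.sum_comm]; simp only [← Finset.mul_sum, hkk1, mul_one, hrP.2]
    have hqqpos : ∀ z A, 0 < r z → 0 < kk z A → 0 < qq A := fun z A h1 h2 =>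
      (mul_pos h1 h2).trans_le (Finset.single_le_sum (f := fun z => r z * kk z A)
        (fun z _ => mul_nonneg (hrP.1 z) (hkk0 z A)) (Finset.mem_univ z))
    have hsplit : ∀ z (x : Finset Ω × Finset Ω), 0 < k z x.1 * kk z x.2 →
        0 < k z x.1 ∧ 0 < kk z x.2 := by
      intro z x h
      constructor
      · exact lt_of_le_of_ne (hk0 _ _) (by intro hx; simp [← hx] at h)
      · exact lt_of_le_of_ne (hkk0 _ _) (by intro hx; simp [← hx] at h)
    have hb := Hent_le_push r hrP ((Y ∩ X) ∩ E.powerset)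
      (fun z (x : Finset Ω × Finset Ω) => k z x.1 * kk z x.2) (fun x => x.1 ∩ x.2)
      (fun z x => mul_nonneg (hk0 _ _) (hkk0 _ _))
      (fun z => by
        rw [Fintype.sum_prod_type]; simp only [← Finset.mul_sum, hk1, hkk1, mul_one])
      (fun z x h => by
        obtain ⟨h1, h2⟩ := hsplit z x h
        have h3 := hkX _ _ h1
        have h4 := hkkX _ _ h2
        simp only [himpHyp, Finset.mem_filter, Finset.mem_univ, true_and] at h3
        simp only [Finset.mem_inter, Finset.mem_powerset] at h4 ⊢
        have h5 := hX.2 _ h4.1 (x.1 ∩ x.2) Finset.inter_subset_right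
        exact ⟨⟨h3 _ h5 Finset.inter_subset_left, h5⟩, Finset.inter_subset_right.trans h4.2⟩)
      (fun z x hz h => by
        obtain ⟨h1, h2⟩ := hsplit z x h
        exact Finset.mem_inter.2 ⟨hkz _ _ (hrE z hz).2 h1, hkkz _ _ hz h2⟩)
      (fun x => q x.1 * qq x.2) (fun x => mul_nonneg (hq0 _) (hqq0 _))
      (by rw [Fintype.sum_prod_type]; simp only [← Finset.mul_sum, hq1, hqq1, mul_one]; exact le_rfl)
      (fun z x hz h => by
        obtain ⟨h1, h2⟩ := hsplit z x h
        exact mul_pos (hqpos _ _ (hrE z hz).2 h1) (hqqpos _ _ hz h2))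
    refine hb.trans ?_
    refine le_trans (ENNReal.ofReal_le_ofReal (le_of_eq ?_)) ENNReal.ofReal_add_le
    unfold MI
    rw [hM, ← Finset.sum_add_distrib]
    refine Finset.sum_congr rfl fun z _ => ?_
    rcases (hrP.1 z).eq_or_lt with h | hz
    · simp [← h]
    have e : ∀ x : Finset Ω × Finset Ω,
        r z * (k z x.1 * kk z x.2) * Real.logb 2 (k z x.1 * kk z x.2 / (q x.1 * qq x.2)) =
        r z * (k z x.1 * Real.logb 2 (k z x.1 / q x.1)) * kk z x.2 +
        k z x.1 * (r z * kk z x.2 * Real.logb 2 (kk z x.2 / qq x.2)) := by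
      intro x
      rcases (hk0 z x.1).eq_or_lt with h | h1
      · simp [← h]
      rcases (hkk0 z x.2).eq_or_lt with h | h2
      · simp [← h]
      have h3 := hqpos _ _ (hrE z hz).2 h1
      have h4 := hqqpos _ _ hz h2
      rw [mul_div_mul_comm, Real.logb_mul (by positivity) (by positivity)]
      ring
    rw [Finset.sum_congr rfl fun x _ => e x, Finset.sum_add_distrib]
    congr 1
    · rw [Fintype.sum_prod_type]
      simp only [← Finset.mul_sum, hkk1, mul_one, hD]
    · rw [Fintype.sum_prod_type]
      simp only [← Finset.mul_sum]
      rw [← Finset.sum_mul, hk1, one_mul]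
  calc _ ≤ ENNReal.ofReal c * ENNReal.ofReal M := by
        gcongr
        exact tsub_le_iff_right.2 main
    _ = ENNReal.ofReal (c * M) := (ENNReal.ofReal_mul hc.le).symm
    _ ≤ _ := ENNReal.ofReal_le_ofReal hMI

/-- Expectation of a one-coordinate function under a product pmf. -/
lemma sum_prod_coord {τ α : Type*} [Fintype τ] [DecidableEq τ] [Fintype α] (R : τ → α → ℝ)
    (hR : ∀ t, ∑ a, R t a = 1) (t0 : τ) (c g : α → ℝ) :
    ∑ i : τ → α, (∏ t, Function.update R t0 c t (i t)) * g (i t0) = ∑ a, c a * g a := by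
  have e : ∀ i : τ → α, (∏ t, Function.update R t0 c t (i t)) * g (i t0) =
      ∏ t, Function.update R t0 (fun a => c a * g a) t (i t) := by
    intro i
    rw [← Finset.mul_prod_erase _ _ (Finset.mem_univ t0),
      ← Finset.mul_prod_erase (f := fun t => Function.update R t0 (fun a => c a * g a) t (i t))
        _ (Finset.mem_univ t0)]
    have : ∏ t ∈ univ.erase t0, Function.update R t0 c t (i t) =
        ∏ t ∈ univ.erase t0, Function.update R t0 (fun a => c a * g a) t (i t) :=
      Finset.prod_congr rfl fun t ht => by
        rw [Function.update_of_ne (Finset.ne_of_mem_erase ht),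
          Function.update_of_ne (Finset.ne_of_mem_erase ht)]
    rw [this]
    simp only [Function.update_self]
    ring
  rw [Finset.sum_congr rfl fun i _ => e i, ← Fintype.prod_sum,
    Finset.prod_eq_single t0]
  · simp
  · intro t _ ht
    simp [Function.update_of_ne ht, hR]
  · simp

lemma kl_prod_coord {τ α : Type*} [Fintype τ] [DecidableEq τ] [Fintype α] (R : τ → α → ℝ)
    (hR : ∀ t, ∑ a, R t a = 1) (t0 : τ) (c : α → ℝ) :
    ∑ i : τ → α, (∏ t, Function.update R t0 c t (i t)) *
      Real.logb 2 ((∏ t, Function.update R t0 c t (i t)) / ∏ t, R t (i t)) =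
      ∑ a, c a * Real.logb 2 (c a / R t0 a) := by
  rw [← sum_prod_coord R hR t0 c (fun a => Real.logb 2 (c a / R t0 a))]
  refine Finset.sum_congr rfl fun i _ => ?_
  by_cases h : (∏ t, Function.update R t0 c t (i t)) = 0
  · rw [h]; simp
  congr 2
  have e : ∏ t ∈ univ.erase t0, Function.update R t0 c t (i t) =
      ∏ t ∈ univ.erase t0, R t (i t) :=
    Finset.prod_congr rfl fun t ht => by
      rw [Function.update_of_ne (Finset.ne_of_mem_erase ht)]
  rw [← Finset.mul_prod_erase _ _ (Finset.mem_univ t0), e] at h ⊢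
  rw [← Finset.mul_prod_erase (f := fun t => R t (i t)) _ (Finset.mem_univ t0)]
  rw [Function.update_self]
  exact mul_div_mul_right _ _ (right_ne_zero_of_mul h)

lemma part_two [Fintype Ω] (p : Ω → ℝ) (hp : IsPMF p)
    (X Y : Finset (Finset Ω)) (hY : IsHyp Y) (hO : IsOI X) :
    Hent p (himpHyp X Y) ≤ Hcond p Y X := by
  have hYe : ∅ ∈ Y := by
    obtain ⟨A, hA⟩ := hY.1
    exact hY.2 A hA ∅ (Finset.empty_subset _)
  obtain ⟨S, -, hSd, hSX⟩ := hO
  have hEmem : ∀ z, z ∈ suppH X ↔ ∃ t ∈ S, z ∈ t := by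
    intro z; simp [suppH, hSX]
  unfold Hcond
  split_ifs with hE
  · have hpE : ∀ z ∈ suppH X, p z = 0 :=
      (Finset.sum_eq_zero_iff_of_nonneg fun z _ => hp.1 z).1 hE
    refine (Hent_le_push p hp (himpHyp X Y) (fun _ (_ : Unit) => 1) (fun _ => (suppH X)ᶜ)
      (fun _ _ => zero_le_one) (fun _ => by simp) ?_ ?_ (fun _ => 1) (fun _ => zero_le_one)
      (by simp) (fun _ _ _ _ => zero_lt_one)).trans (by simp)
    · intro _ _ _
      simp only [himpHyp, Finset.mem_filter, Finset.mem_univ, true_and]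
      intro B hB hBE
      have : B = ∅ := by
        refine Finset.eq_empty_of_forall_notMem fun b hb => ?_
        obtain ⟨t, ht, hBt⟩ := (hSX B).1 hB
        exact Finset.mem_compl.1 (hBE hb) ((hEmem b).2 ⟨t, ht, hBt hb⟩)
      rw [this]; exact hYe
    · intro z _ hz _
      exact Finset.mem_compl.2 fun h => hz.ne' (hpE z h)
  set E := suppH X with hEdef
  have hc : 0 < pset p E :=
    lt_of_le_of_ne (Finset.sum_nonneg fun z _ => hp.1 z) (Ne.symm hE)
  set c := pset p E with hcdef
  set r := condP p E with hr
  have hrP : IsPMF r := condP_isPMF p hp E hE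
  have hrE : ∀ z, 0 < r z → z ∈ E ∧ 0 < p z := by
    intro z h
    simp only [hr, condP] at h
    split_ifs at h with hz
    · exact ⟨hz, by have := (div_pos_iff_of_pos_right hc).1 h; exact this⟩
    · exact absurd h (lt_irrefl _)
  have hcr : ∀ z ∈ E, c * r z = p z := by
    intro z hz
    simp only [hr, condP, if_pos hz]
    exact mul_div_cancel₀ _ hE
  have hTex : ∀ z, ∃ t : Finset Ω, (z ∈ E → t ∈ S ∧ z ∈ t) ∧ (z ∉ E → t = ∅) := by
    intro z
    by_cases hz : z ∈ E
    · obtain ⟨t, h1, h2⟩ := (hEmem z).1 hz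
      exact ⟨t, fun _ => ⟨h1, h2⟩, fun h => absurd hz h⟩
    · exact ⟨∅, fun h => absurd h hz, fun _ => rfl⟩
  choose T hT1 hT0 using hTex
  have hT2 : ∀ z, ∀ t ∈ S, z ∈ t → T z = t := by
    intro z t ht hz
    obtain ⟨h1, h2⟩ := hT1 z ((hEmem z).2 ⟨t, ht, hz⟩)
    by_contra hne
    exact Finset.disjoint_left.1 (hSd _ h1 _ ht hne) h2 hz
  set P : Finset Ω → ℝ := fun t => ∑ z, if T z = t then r z else 0 with hP
  have hP0 : ∀ t, 0 ≤ P t := fun t =>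
    Finset.sum_nonneg fun z _ => by split_ifs; exacts [hrP.1 z, le_rfl]
  have hP1 : ∑ t, P t = 1 := by
    simp only [hP]; rw [Finset.sum_comm]; simp [hrP.2]
  have hPpos : ∀ z, 0 < r z → 0 < P (T z) := by
    intro z hz
    have := Finset.single_le_sum (f := fun w => if T w = T z then r w else 0)
      (fun j _ => by split_ifs; exacts [hrP.1 j, le_rfl]) (Finset.mem_univ z)
    simp only [if_true] at this
    exact hz.trans_le this
  set h := ∑ z, r z * Real.logb 2 (1 / P (T z)) with hh
  have hh0 : 0 ≤ h := Finset.sum_nonneg fun z _ => by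
    rcases (hrP.1 z).eq_or_lt with h | hz
    · simp [← h]
    · refine mul_nonneg hz.le (Real.logb_nonneg (by norm_num) ?_)
      rw [le_div_iff₀ (hPpos z hz), one_mul, ← hP1]
      exact Finset.single_le_sum (fun t _ => hP0 t) (Finset.mem_univ _)
  have hHX : HcondEvent p X E ≤ ENNReal.ofReal h := by
    unfold HcondEvent
    rw [← hr]
    by_cases hXS : ∀ z, T z ∈ X ∩ E.powerset
    · refine (Hent_le_push r hrP (X ∩ E.powerset) (fun z A => if A = T z then 1 else 0) id
        (fun z A => by split_ifs <;> norm_num) (fun z => by simp) ?_ ?_ P hP0 hP1.le ?_).trans ?_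
      · intro z A hA
        by_cases hx : A = T z
        · rw [hx]; exact hXS z
        · simp [hx] at hA
      · intro z A hz hA
        by_cases hx : A = T z
        · rw [hx]; exact (hT1 z (hrE z hz).1).2
        · simp [hx] at hA
      · intro z A hz hA
        by_cases hx : A = T z
        · rw [hx]; exact hPpos z hz
        · simp [hx] at hA
      · refine ENNReal.ofReal_le_ofReal (le_of_eq ?_)
        rw [hh]
        refine Finset.sum_congr rfl fun z _ => ?_
        rw [Finset.sum_eq_single (T z)]
        · simp
        · intro A _ hA; simp [hA]
        · simp
    · exfalso
      apply hXS
      intro z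
      rw [Finset.mem_inter, Finset.mem_powerset]
      by_cases hz : z ∈ E
      · obtain ⟨h1, h2⟩ := hT1 z hz
        exact ⟨(hSX _).2 ⟨_, h1, Finset.Subset.refl _⟩,
          fun w hw => (hEmem w).2 ⟨_, h1, hw⟩⟩
      · rw [hT0 z hz]
        refine ⟨?_, Finset.empty_subset _⟩
        obtain ⟨w, hw⟩ : E.Nonempty := by
          by_contra hne
          rw [Finset.not_nonempty_iff_eq_empty] at hne
          rw [hcdef, hne] at hc
          simp [pset] at hc
        exact (hSX _).2 ⟨_, (hT1 w hw).1, Finset.empty_subset _⟩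
  have main : Hent p (himpHyp X Y) / ENNReal.ofReal c + ENNReal.ofReal h ≤
      HcondEvent p (Y ∩ X) E := by
    unfold HcondEvent
    rw [← hr]
    conv_rhs => unfold Hent
    refine le_iInf₂ fun k hk => ?_
    obtain ⟨hk0, hk1, hkX, hkz⟩ := hk
    set R : Finset Ω → Finset Ω → ℝ := fun t A =>
      if P t = 0 then (if A = ∅ then 1 else 0)
      else (∑ z, if T z = t then r z * k z A else 0) / P t with hR
    have hs0 : ∀ t A, 0 ≤ ∑ z, if T z = t then r z * k z A else 0 := fun t A =>
      Finset.sum_nonneg fun z _ => by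
        split_ifs
        exacts [mul_nonneg (hrP.1 z) (hk0 z A), le_rfl]
    have hR0 : ∀ t A, 0 ≤ R t A := by
      intro t A
      simp only [hR]
      split_ifs
      · exact zero_le_one
      · exact le_rfl
      · exact div_nonneg (hs0 t A) (hP0 t)
    have hR1 : ∀ t, ∑ A, R t A = 1 := by
      intro t
      by_cases hPt : P t = 0
      · simp [hR, hPt]
      · simp only [hR, hPt, if_false, ← Finset.sum_div]
        rw [Finset.sum_comm]
        have : ∀ z, (∑ A, if T z = t then r z * k z A else 0) = if T z = t then r z else 0 := by
          intro z
          split_ifs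
          · rw [← Finset.mul_sum, hk1, mul_one]
          · simp
        rw [Finset.sum_congr rfl fun z _ => this z]
        exact div_self hPt
    have hRY : ∀ t A, 0 < R t A → A ∈ Y := by
      intro t A hA
      simp only [hR] at hA
      split_ifs at hA with h1 h2
      · rw [h2]; exact hYe
      · exact absurd hA (lt_irrefl _)
      · by_contra hAY
        have : ∀ z, k z A = 0 := by
          intro z
          refine le_antisymm (not_lt.1 fun hz => hAY ?_) (hk0 z A)
          have := hkX z A hz
          simp only [Finset.mem_inter] at this
          exact this.1.1
        simp [this] at hA
    have hRpos : ∀ z A, 0 < r z → 0 < k z A → 0 < R (T z) A := by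
      intro z A hz hA
      have h1 := hPpos z hz
      simp only [hR, h1.ne', if_false]
      refine div_pos ?_ h1
      have := Finset.single_le_sum (f := fun w => if T w = T z then r w * k w A else 0)
        (fun j _ => by split_ifs; exacts [mul_nonneg (hrP.1 j) (hk0 j A), le_rfl])
        (Finset.mem_univ z)
      simp only [if_true] at this
      exact (mul_pos hz hA).trans_le this
    set d : Ω → Finset Ω → ℝ := fun z => if 0 < r z then k z else R (T z) with hd
    have hd0 : ∀ z A, 0 ≤ d z A := by
      intro z A; simp only [hd]; split_ifs; exacts [hk0 z A, hR0 _ A]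
    have hd1 : ∀ z, ∑ A, d z A = 1 := by
      intro z; simp only [hd]; split_ifs; exacts [hk1 z, hR1 _]
    have hdR : ∀ z A, 0 < d z A → 0 < R (T z) A := by
      intro z A hA
      simp only [hd] at hA
      split_ifs at hA with hz
      exacts [hRpos z A hz hA, hA]
    have hU0 : ∀ z t A, 0 ≤ Function.update R (T z) (d z) t A := by
      intro z t A
      by_cases ht : t = T z
      · subst ht; rw [Function.update_self]; exact hd0 z A
      · rw [Function.update_of_ne ht]; exact hR0 t A
    set K : Ω → (Finset Ω → Finset Ω) → ℝ :=
      fun z i => ∏ t, Function.update R (T z) (d z) t (i t) with hK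
    have hKpos : ∀ z i, 0 < K z i → ∀ t, 0 < Function.update R (T z) (d z) t (i t) := by
      intro z i hi t
      exact lt_of_le_of_ne (hU0 _ _ _)
        (Ne.symm (Finset.prod_ne_zero_iff.1 hi.ne' t (Finset.mem_univ t)))
    have hKR : ∀ z i, 0 < K z i → ∀ t, 0 < R t (i t) := by
      intro z i hi t
      have h1 := hKpos z i hi t
      by_cases ht : t = T z
      · subst ht; rw [Function.update_self] at h1; exact hdR z _ h1
      · rwa [Function.update_of_ne ht] at h1
    set D : Ω → ℝ := fun z => ∑ A, k z A * Real.logb 2 (k z A / R (T z) A) with hD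
    have hb := Hent_le_push p hp (himpHyp X Y) K
      (fun i => univ.filter fun z => z ∈ E → z ∈ i (T z))
      (fun z i => Finset.prod_nonneg fun t _ => hU0 _ _ _)
      (fun z => by
        have := sum_prod_coord R hR1 (T z) (d z) (fun _ => 1)
        simp only [mul_one, hd1] at this
        exact this)
      (fun z i hi => by
        simp only [himpHyp, Finset.mem_filter, Finset.mem_univ, true_and]
        intro B hB hBf
        obtain ⟨t, ht, hBt⟩ := (hSX B).1 hB
        refine hY.2 _ (hRY t (i t) (hKR z i hi t)) B fun b hb => ?_
        have h1 := (Finset.mem_filter.1 (hBf hb)).2 ((hEmem b).2 ⟨t, ht, hBt hb⟩)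
        rwa [hT2 b t ht (hBt hb)] at h1)
      (fun z i hz hi => by
        simp only [Finset.mem_filter, Finset.mem_univ, true_and]
        intro hzE
        have hrz : 0 < r z := pos_of_mul_pos_right (by rw [hcr z hzE]; exact hz) hc.le
        have h1 := hKpos z i hi (T z)
        rw [Function.update_self] at h1
        simp only [hd, hrz, if_true] at h1
        exact hkz z _ hrz h1)
      (fun i => ∏ t, R t (i t)) (fun i => Finset.prod_nonneg fun t _ => hR0 _ _)
      (by rw [← Fintype.prod_sum]; simp [hR1])
      (fun z i _ hi => Finset.prod_pos fun t _ => hKR z i hi t)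
    have hsum : ∑ z, ∑ i, p z * K z i * Real.logb 2 (K z i / ∏ t, R t (i t)) =
        c * ∑ z, r z * D z := by
      rw [Finset.mul_sum]
      refine Finset.sum_congr rfl fun z _ => ?_
      simp only [mul_assoc, ← Finset.mul_sum]
      have := kl_prod_coord R hR1 (T z) (d z)
      rw [show (∑ i, K z i * Real.logb 2 (K z i / ∏ t, R t (i t))) = _ from this]
      rcases (hrP.1 z).eq_or_lt with h0 | hz
      · have : ¬ 0 < r z := by rw [← h0]; exact lt_irrefl _
        simp only [hd, this, if_false]
        rw [← h0]
        simp only [zero_mul, mul_zero]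
        rw [Finset.sum_eq_zero, mul_zero]
        intro A _
        by_cases hA : R (T z) A = 0
        · simp [hA]
        · rw [div_self hA]; simp
      · simp only [hd, hz, if_true]
        rw [← mul_assoc, hcr z (hrE z hz).1]
    have hM0 : 0 ≤ ∑ z, r z * D z := Finset.sum_nonneg fun z _ => by
      rcases (hrP.1 z).eq_or_lt with h | hz
      · simp [← h]
      · exact mul_nonneg hz.le (gibbs_aux (k z) (R (T z)) (hk0 z) (hR0 _)
          (fun A hA => hRpos z A hz hA) (by rw [hR1, hk1]))
    have hMI : MI r k = ∑ z, r z * D z + h := by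
      unfold MI
      rw [hh, ← Finset.sum_add_distrib]
      refine Finset.sum_congr rfl fun z _ => ?_
      rcases (hrP.1 z).eq_or_lt with h | hz
      · simp [← h]
      have e : ∀ A, r z * k z A * Real.logb 2 (k z A / ∑ z', r z' * k z' A) =
          r z * (k z A * Real.logb 2 (k z A / R (T z) A)) +
          k z A * (r z * Real.logb 2 (1 / P (T z))) := by
        intro A
        rcases (hk0 z A).eq_or_lt with h | hA
        · simp [← h]
        have h1 := hPpos z hz
        have h2 := hRpos z A hz hA
        have h3 : ∑ z', r z' * k z' A = R (T z) A * P (T z) := by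
          simp only [hR, h1.ne', if_false]
          rw [div_mul_cancel₀ _ h1.ne']
          refine Finset.sum_congr rfl fun w _ => ?_
          split_ifs with hw
          · rfl
          by_contra hne
          have hrw : 0 < r w := lt_of_le_of_ne (hrP.1 w) (by intro hx; simp [← hx] at hne)
          have hkw : 0 < k w A := lt_of_le_of_ne (hk0 w A) (by intro hx; simp [← hx] at hne)
          have hAX := hkX z A hA
          simp only [Finset.mem_inter] at hAX
          obtain ⟨t, ht, hAt⟩ := (hSX A).1 hAX.1.2
          apply hw
          rw [hT2 w t ht (hAt (hkz w A hrw hkw)), hT2 z t ht (hAt (hkz z A hz hA))]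
        rw [h3, show k z A / (R (T z) A * P (T z)) = k z A / R (T z) A * (1 / P (T z)) by
          field_simp, Real.logb_mul (by positivity) (by positivity)]
        ring
      rw [Finset.sum_congr rfl fun A _ => e A, Finset.sum_add_distrib, ← Finset.mul_sum,
        ← Finset.sum_mul, hk1, one_mul]
    rw [hMI, ENNReal.ofReal_add hM0 hh0]
    gcongr
    refine ENNReal.div_le_of_le_mul' ?_
    rw [← ENNReal.ofReal_mul hc.le, ← hsum]
    exact hb
  have hc0 : ENNReal.ofReal c ≠ 0 := by simpa using hc
  have h1 : Hent p (himpHyp X Y) / ENNReal.ofReal c ≤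
      HcondEvent p (Y ∩ X) E - HcondEvent p X E := by
    refine le_trans ?_ (tsub_le_tsub_left hHX _)
    exact ENNReal.le_sub_of_add_le_right ENNReal.ofReal_ne_top main
  rw [mul_comm]
  exact (ENNReal.div_le_iff hc0 ENNReal.ofReal_ne_top).1 h1

/-- `H(X→Y) ≥ H(Y|X)` for the Heyting implication, with equality
when `X` is an ordinary information. -/
theorem stmt13 [Fintype Ω] (p : Ω → ℝ) (hp : IsPMF p)
    (X Y : Finset (Finset Ω)) (hX : IsHyp X) (hY : IsHyp Y) :
    Hcond p Y X ≤ Hent p (himpHyp X Y) ∧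
    (IsOI X → Hent p (himpHyp X Y) = Hcond p Y X) :=
  ⟨part_one p hp X Y hX hY, fun hO =>
    le_antisymm (part_two p hp X Y hY hO) (part_one p hp X Y hX hY)⟩

end
end
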